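/- Existence of local solutions of the conformal Laplace equation with prescribed value and differential at a point (Lemma B.1, part 1): Let n ≥ 3, k ∈ ℕ with k ≥ 2, and α ∈ (0,1). Let Ω ⊆ ℝⁿ be an open neighborhood of 0 and let g be a metric of class C^{k+α} on Ω. Then for every σ ∈ ℝⁿ there exist ε > 0 with closed ball B̄(0,ε) ⊆ Ω and a function f^σ of class C^{k+α} on an open neighborhood of B̄(0,ε) such that L_g f^σ = 0 on B̄(0,ε), f^σ(0) = 0, and ∇f^σ(0) = σ. Moreover, there exist ε > 0 and a function f of class C^{k+α} on an open neighborhood of B̄(0,ε) such that L_g f = 0 on B̄(0,ε), f > 0 on B̄(0,ε), and f(0) = 1. -/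

import Mathlib

noncomputable section

open Set Matrix Matrix

/-- Points of `ℝⁿ`. -/
abbrev Pt (n : ℕ) := Fin n → ℝ

/-- A metric in coordinates: a matrix-valued map. -/
abbrev Met (n : ℕ) := Pt n → Matrix (Fin n) (Fin n) ℝ

/-- Partial derivative of `f` in the `a`-th coordinate direction. -/
def pd {n : ℕ} (a : Fin n) (f : Pt n → ℝ) (x : Pt n) : ℝ :=
  fderiv ℝ f x (Pi.single a 1)

/-- `g` is a metric (pointwise symmetric positive definite) on `U`. -/
def IsMetricOn {n : ℕ} (g : Met n) (U : Set (Pt n)) : Prop :=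
  ∀ x ∈ U, (g x).IsSymm ∧ (g x).PosDef

/-- Christoffel symbols `Γ^c_{ab}` of `g`. -/
def christoffel {n : ℕ} (g : Met n) (c a b : Fin n) (x : Pt n) : ℝ :=
  (1 / 2) * ∑ d, (g x)⁻¹ c d *
    (pd a (fun y => g y b d) x + pd b (fun y => g y a d) x - pd d (fun y => g y a b) x)

/-- Ricci tensor `R_{ab}` of `g`. -/
def ricci {n : ℕ} (g : Met n) (a b : Fin n) (x : Pt n) : ℝ :=
  (∑ c, pd c (christoffel g c a b) x) - (∑ c, pd a (christoffel g c c b) x)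
    + (∑ c, ∑ d, christoffel g c a b x * christoffel g d d c x)
    - (∑ c, ∑ d, christoffel g d c b x * christoffel g c a d x)

/-- Scalar curvature `R(g)`. -/
def scalarCurv {n : ℕ} (g : Met n) (x : Pt n) : ℝ :=
  ∑ a, ∑ b, (g x)⁻¹ a b * ricci g a b x

/-- Laplace–Beltrami operator `Δ_g`. -/
def laplaceBeltrami {n : ℕ} (g : Met n) (u : Pt n → ℝ) (x : Pt n) : ℝ :=
  -(Real.sqrt (g x).det)⁻¹ *
    ∑ a, pd a (fun y => Real.sqrt (g y).det * ∑ b, (g y)⁻¹ a b * pd b u y) x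

/-- Conformal Laplacian `L_g`. -/
def confLap {n : ℕ} (g : Met n) (u : Pt n → ℝ) (x : Pt n) : ℝ :=
  laplaceBeltrami g u x + (((n : ℝ) - 2) / (4 * ((n : ℝ) - 1))) * scalarCurv g x * u x

/-- `f` is of class `C^{k+α}` on `s`: it is `C^k` there and its `k`-th order derivatives are
locally `α`-Hölder continuous. -/
def CHolderOn {n : ℕ} (k : ℕ) (α : ℝ) (s : Set (Pt n)) (f : Pt n → ℝ) : Prop :=
  ContDiffOn ℝ k f s ∧
    ∀ x ∈ s, ∃ C : NNReal, ∃ t ∈ nhdsWithin x s,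
      HolderOnWith C (Real.toNNReal α) (iteratedFDerivWithin ℝ k f s) t

/-- All entries of `g` are of class `C^{k+α}` on `s`. -/
def MetCHolderOn {n : ℕ} (k : ℕ) (α : ℝ) (s : Set (Pt n)) (g : Met n) : Prop :=
  ∀ a b, CHolderOn k α s fun x => g x a b

/-- Contracted Christoffel symbol `Γ^a = g^{bc} Γ^a_{bc}`. -/
def gammaUp {n : ℕ} (g : Met n) (a : Fin n) (x : Pt n) : ℝ :=
  ∑ b, ∑ c, (g x)⁻¹ b c * christoffel g a b c x

/-- Contracted Christoffel symbol `Γ_a = g_{ab} Γ^b`. -/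
def gammaLow {n : ℕ} (g : Met n) (a : Fin n) (x : Pt n) : ℝ :=
  ∑ b, g x a b * gammaUp g b x

/-- `g` satisfies the conformal harmonic gauge on `U`. -/
def ConfHarmonicGauge {n : ℕ} (g : Met n) (U : Set (Pt n)) : Prop :=
  ∃ f : Pt n → ℝ, ContDiffOn ℝ 2 f U ∧ (∀ x ∈ U, 0 < f x) ∧
    (∀ x ∈ U, confLap g f x = 0) ∧
    ∀ a : Fin n, ∀ x ∈ U, gammaLow g a x = 2 * pd a (fun y => Real.log (f y)) x

/-- Determinant-normalized metric `ĝ = (det g)^{-1/n} g`. -/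
def dnorm {n : ℕ} (g : Met n) : Met n :=
  fun x => ((g x).det ^ (-(1 : ℝ) / (n : ℝ))) • g x

/-- Jacobian matrix of a map `Z : ℝⁿ → ℝⁿ`. -/
def jac {n : ℕ} (Z : Pt n → Pt n) (x : Pt n) : Matrix (Fin n) (Fin n) ℝ :=
  Matrix.of fun i j => pd j (fun y => Z y i) x

/-- Riemann curvature tensor `R_{abc}{}^{d}`. -/
def riemannUp {n : ℕ} (g : Met n) (a b c d : Fin n) (x : Pt n) : ℝ :=
  pd a (christoffel g d b c) x - pd b (christoffel g d a c) x
    + (∑ e, christoffel g e b c x * christoffel g d a e x)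
    - (∑ e, christoffel g e a c x * christoffel g d b e x)

/-- Riemann curvature tensor `R_{abcd} = R_{abc}{}^{e} g_{ed}`. -/
def riemannLow {n : ℕ} (g : Met n) (a b c d : Fin n) (x : Pt n) : ℝ :=
  ∑ e, riemannUp g a b c e x * g x e d

/-- Schouten tensor `P_{ab}`. -/
def schouten {n : ℕ} (g : Met n) (a b : Fin n) (x : Pt n) : ℝ :=
  (1 / ((n : ℝ) - 2)) * (ricci g a b x - (scalarCurv g x / (2 * ((n : ℝ) - 1))) * g x a b)

/-- Weyl tensor `W_{abcd}`. -/
def weyl {n : ℕ} (g : Met n) (a b c d : Fin n) (x : Pt n) : ℝ :=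
  riemannLow g a b c d x + schouten g a c x * g x b d - schouten g b c x * g x a d
    + schouten g b d x * g x a c - schouten g a d x * g x b c

/-- Weyl tensor with raised last index, `W_{abc}{}^{d} = g^{de} W_{abce}`. -/
def weylUp {n : ℕ} (g : Met n) (a b c d : Fin n) (x : Pt n) : ℝ :=
  ∑ e, (g x)⁻¹ d e * weyl g a b c e x

/-- Covariant derivative of a 2-tensor: `(∇T)_{cab} = ∇_c T_{ab}`. -/
def cov2 {n : ℕ} (g : Met n) (T : Fin n → Fin n → Pt n → ℝ) (c a b : Fin n) (x : Pt n) : ℝ :=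
  pd c (T a b) x - (∑ d, christoffel g d c a x * T d b x)
    - ∑ d, christoffel g d c b x * T a d x

/-- Covariant derivative of a 3-tensor: `(∇T)_{dabc} = ∇_d T_{abc}`. -/
def cov3 {n : ℕ} (g : Met n) (T : Fin n → Fin n → Fin n → Pt n → ℝ) (d a b c : Fin n)
    (x : Pt n) : ℝ :=
  pd d (T a b c) x - (∑ e, christoffel g e d a x * T e b c x)
    - (∑ e, christoffel g e d b x * T a e c x)
    - ∑ e, christoffel g e d c x * T a b e x

/-- Cotton tensor `C_{abc} = ∇_a P_{bc} - ∇_b P_{ac}`. -/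
def cotton {n : ℕ} (g : Met n) (a b c : Fin n) (x : Pt n) : ℝ :=
  cov2 g (schouten g) a b c x - cov2 g (schouten g) b a c x

/-- Bach tensor `B_{ab}`. -/
def bach {n : ℕ} (g : Met n) (a b : Fin n) (x : Pt n) : ℝ :=
  (∑ c, ∑ d, (g x)⁻¹ c d *
      (cov3 g (cov2 g (schouten g)) d a b c x - cov3 g (cov2 g (schouten g)) d c a b x))
    + ∑ c, ∑ d, ∑ e, ∑ f, (g x)⁻¹ c e * (g x)⁻¹ d f * schouten g e f x * weyl g a c d b x

/-! ### Partial derivatives -/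

lemma clm_eq_sum_proj {n : ℕ} (L : Pt n →L[ℝ] ℝ) :
    L = ∑ a, L (Pi.single a 1) • ContinuousLinearMap.proj (R := ℝ) (φ := fun _ : Fin n => ℝ) a := by
  ext x
  have : x = ∑ a, x a • (Pi.single a (1 : ℝ) : Pt n) := by
    ext i
    simp [Finset.sum_apply, Pi.single_apply]
  conv_lhs => rw [this]
  simp [map_sum, mul_comm]

lemma clm_norm_le_sum {n : ℕ} (L : Pt n →L[ℝ] ℝ) : ‖L‖ ≤ ∑ a, |L (Pi.single a 1)| := by
  refine L.opNorm_le_bound (by positivity) fun x => ?_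
  conv_lhs => rw [clm_eq_sum_proj L]
  simp only [_root_.sum_apply, _root_.smul_apply,
    ContinuousLinearMap.proj_apply, smul_eq_mul]
  refine (norm_sum_le _ _).trans ?_
  rw [Finset.sum_mul]
  refine Finset.sum_le_sum fun a _ => ?_
  rw [norm_mul]
  exact mul_le_mul_of_nonneg_left (norm_le_pi_norm x a) (abs_nonneg _)

lemma pd_congr {n : ℕ} {s : Set (Pt n)} (hs : IsOpen s) {f g : Pt n → ℝ} (h : EqOn f g s)
    (a : Fin n) : EqOn (pd a f) (pd a g) s := fun x hx => by
  simp only [pd]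
  rw [Filter.EventuallyEq.fderiv_eq (Filter.eventuallyEq_of_mem (hs.mem_nhds hx) h)]

lemma pd_add {n : ℕ} {f g : Pt n → ℝ} {x : Pt n} (hf : DifferentiableAt ℝ f x)
    (hg : DifferentiableAt ℝ g x) (a : Fin n) :
    pd a (fun y => f y + g y) x = pd a f x + pd a g x := by
  simp [pd, fderiv_fun_add hf hg]

lemma pd_sub {n : ℕ} {f g : Pt n → ℝ} {x : Pt n} (hf : DifferentiableAt ℝ f x)
    (hg : DifferentiableAt ℝ g x) (a : Fin n) :
    pd a (fun y => f y - g y) x = pd a f x - pd a g x := by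
  simp [pd, fderiv_fun_sub hf hg]

lemma pd_mul {n : ℕ} {f g : Pt n → ℝ} {x : Pt n} (hf : DifferentiableAt ℝ f x)
    (hg : DifferentiableAt ℝ g x) (a : Fin n) :
    pd a (fun y => f y * g y) x = pd a f x * g x + f x * pd a g x := by
  simp [pd, fderiv_fun_mul hf hg]; ring

lemma pd_const {n : ℕ} (c : ℝ) (a : Fin n) : pd a (fun _ : Pt n => c) = fun _ => 0 := by
  ext x; simp [pd]

lemma pd_const_mul {n : ℕ} {f : Pt n → ℝ} {x : Pt n} (hf : DifferentiableAt ℝ f x)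
    (c : ℝ) (a : Fin n) : pd a (fun y => c * f y) x = c * pd a f x := by
  simp [pd, fderiv_const_mul hf]

lemma pd_sum {n : ℕ} {ι : Type*} (t : Finset ι) {f : ι → Pt n → ℝ} {x : Pt n}
    (hf : ∀ i ∈ t, DifferentiableAt ℝ (f i) x) (a : Fin n) :
    pd a (fun y => ∑ i ∈ t, f i y) x = ∑ i ∈ t, pd a (f i) x := by
  simp [pd, fderiv_fun_sum hf]

lemma pd_coord {n : ℕ} (a b : Fin n) :
    pd a (fun y : Pt n => y b) = fun _ => if b = a then 1 else 0 := by
  ext x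
  have : fderiv ℝ (fun y : Pt n => y b) x = ContinuousLinearMap.proj b :=
    (ContinuousLinearMap.proj (R := ℝ) (φ := fun _ : Fin n => ℝ) b).hasFDerivAt.fderiv
  simp [pd, this, Pi.single_apply]

lemma pd_comp_smul {n : ℕ} {f : Pt n → ℝ} {ρ : ℝ} {x : Pt n}
    (hf : DifferentiableAt ℝ f (ρ • x)) (a : Fin n) :
    pd a (fun y => f (ρ • y)) x = ρ * pd a f (ρ • x) := by
  have h : HasFDerivAt (fun y : Pt n => f (ρ • y))
      ((fderiv ℝ f (ρ • x)).comp (ρ • ContinuousLinearMap.id ℝ (Pt n))) x :=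
    hf.hasFDerivAt.comp x ((hasFDerivAt_id x).const_smul ρ)
  simp [pd, h.fderiv]

/-! ### Quantitative Hölder classes -/

/-- `f` has all partial derivatives of order `≤ m` on `s`, bounded by `N`, and those of order `m`
are `α`-Hölder continuous on `s` with constant `N`. -/
def HolderBound {n : ℕ} (α : ℝ) (s : Set (Pt n)) : ℕ → ℝ → (Pt n → ℝ) → Prop
  | 0, N, f => 0 ≤ N ∧ (∀ x ∈ s, |f x| ≤ N) ∧ ∀ x ∈ s, ∀ y ∈ s, |f x - f y| ≤ N * ‖x - y‖ ^ α
  | m + 1, N, f => 0 ≤ N ∧ (∀ x ∈ s, |f x| ≤ N) ∧ (∀ x ∈ s, DifferentiableAt ℝ f x) ∧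
      ∀ a, HolderBound α s m N (pd a f)

namespace HolderBound

variable {n : ℕ} {α : ℝ} {s : Set (Pt n)} {m : ℕ} {N M : ℝ} {f g : Pt n → ℝ}

lemma nonneg (h : HolderBound α s m N f) : 0 ≤ N := by
  cases m <;> exact h.1

lemma bound (h : HolderBound α s m N f) : ∀ x ∈ s, |f x| ≤ N := by
  cases m <;> exact h.2.1

lemma differentiableAt (h : HolderBound α s (m + 1) N f) : ∀ x ∈ s, DifferentiableAt ℝ f x :=
  h.2.2.1

lemma pd (h : HolderBound α s (m + 1) N f) (a : Fin n) : HolderBound α s m N (pd a f) :=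
  h.2.2.2 a

lemma mono_const (h : HolderBound α s m N f) (hNM : N ≤ M) : HolderBound α s m M f := by
  induction m generalizing f with
  | zero =>
    exact ⟨h.1.trans hNM, fun x hx => (h.2.1 x hx).trans hNM, fun x hx y hy =>
      (h.2.2 x hx y hy).trans (mul_le_mul_of_nonneg_right hNM (by positivity))⟩
  | succ m ih =>
    exact ⟨h.1.trans hNM, fun x hx => (h.2.1 x hx).trans hNM, h.2.2.1, fun a => ih (h.2.2.2 a)⟩

lemma mono_set {t : Set (Pt n)} (h : HolderBound α s m N f) (hts : t ⊆ s) :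
    HolderBound α t m N f := by
  induction m generalizing f with
  | zero =>
    exact ⟨h.1, fun x hx => h.2.1 x (hts hx), fun x hx y hy => h.2.2 x (hts hx) y (hts hy)⟩
  | succ m ih =>
    exact ⟨h.1, fun x hx => h.2.1 x (hts hx), fun x hx => h.2.2.1 x (hts hx),
      fun a => ih (h.2.2.2 a)⟩

lemma congr (h : HolderBound α s m N f) (hs : IsOpen s) (hfg : EqOn f g s) :
    HolderBound α s m N g := by
  induction m generalizing f g with
  | zero =>
    exact ⟨h.1, fun x hx => by rw [← hfg hx]; exact h.2.1 x hx, fun x hx y hy => by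
      rw [← hfg hx, ← hfg hy]; exact h.2.2 x hx y hy⟩
  | succ m ih =>
    exact ⟨h.1, fun x hx => by rw [← hfg hx]; exact h.2.1 x hx, fun x hx =>
      (h.2.2.1 x hx).congr_of_eventuallyEq
        (Filter.eventuallyEq_of_mem (hs.mem_nhds hx) hfg.symm), fun a =>
      ih (h.2.2.2 a) (pd_congr hs hfg a)⟩

lemma add (hs : IsOpen s) (hf : HolderBound α s m N f) (hg : HolderBound α s m M g) :
    HolderBound α s m (N + M) (fun x => f x + g x) := by
  induction m generalizing f g with
  | zero =>
    refine ⟨add_nonneg hf.1 hg.1, fun x hx => (abs_add_le _ _).trans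
      (add_le_add (hf.2.1 x hx) (hg.2.1 x hx)), fun x hx y hy => ?_⟩
    have := add_le_add (hf.2.2 x hx y hy) (hg.2.2 x hx y hy)
    rw [add_mul]
    refine le_trans ?_ this
    rw [add_sub_add_comm]
    exact abs_add_le _ _
  | succ m ih =>
    refine ⟨add_nonneg hf.1 hg.1, fun x hx => (abs_add_le _ _).trans
      (add_le_add (hf.2.1 x hx) (hg.2.1 x hx)),
      fun x hx => (hf.2.2.1 x hx).add (hg.2.2.1 x hx), fun a => ?_⟩
    exact (ih (hf.2.2.2 a) (hg.2.2.2 a)).congr hs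
      fun x hx => (pd_add (hf.2.2.1 x hx) (hg.2.2.1 x hx) a).symm

lemma const_mul (hs : IsOpen s) (hf : HolderBound α s m N f) (c : ℝ) :
    HolderBound α s m (|c| * N) (fun x => c * f x) := by
  induction m generalizing f with
  | zero =>
    refine ⟨mul_nonneg (abs_nonneg _) hf.1, fun x hx => ?_, fun x hx y hy => ?_⟩
    · rw [abs_mul]; exact mul_le_mul_of_nonneg_left (hf.2.1 x hx) (abs_nonneg _)
    · rw [← mul_sub, abs_mul, mul_assoc]
      exact mul_le_mul_of_nonneg_left (hf.2.2 x hx y hy) (abs_nonneg _)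
  | succ m ih =>
    refine ⟨mul_nonneg (abs_nonneg _) hf.1, fun x hx => ?_,
      fun x hx => (hf.2.2.1 x hx).const_mul c, fun a => ?_⟩
    · rw [abs_mul]; exact mul_le_mul_of_nonneg_left (hf.2.1 x hx) (abs_nonneg _)
    · exact (ih (hf.2.2.2 a)).congr hs fun x hx => (pd_const_mul (hf.2.2.1 x hx) c a).symm

lemma neg (hs : IsOpen s) (hf : HolderBound α s m N f) :
    HolderBound α s m N (fun x => -f x) := by
  simpa using hf.const_mul hs (-1)

lemma sub (hs : IsOpen s) (hf : HolderBound α s m N f) (hg : HolderBound α s m M g) :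
    HolderBound α s m (N + M) (fun x => f x - g x) := by
  simpa [sub_eq_add_neg] using hf.add hs (hg.neg hs)

lemma const (c : ℝ) : HolderBound α s m |c| (fun _ => c) := by
  have hz : ∀ (m : ℕ) (N : ℝ), 0 ≤ N → HolderBound α s m N (fun _ => 0) := by
    intro m N hN
    induction m with
    | zero => exact ⟨hN, by simpa using fun _ _ => hN, fun x _ y _ => by simp; positivity⟩
    | succ m ih => exact ⟨hN, by simpa using fun _ _ => hN, by fun_prop, fun a => by
        rw [pd_const]; exact ih⟩
  cases m with
  | zero => exact ⟨abs_nonneg _, by simp, fun x _ y _ => by simp; positivity⟩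
  | succ m =>
    exact ⟨abs_nonneg _, by simp, by fun_prop, fun a => by
      rw [pd_const]; exact hz _ _ (abs_nonneg _)⟩

lemma sum (hs : IsOpen s) {ι : Type*} (t : Finset ι) {F : ι → Pt n → ℝ} {B : ι → ℝ}
    (h : ∀ i ∈ t, HolderBound α s m (B i) (F i)) :
    HolderBound α s m (∑ i ∈ t, B i) (fun x => ∑ i ∈ t, F i x) := by
  classical
  induction t using Finset.induction_on with
  | empty => simpa using HolderBound.const (α := α) (s := s) (m := m) 0
  | insert i t hi ih =>
    simp only [Finset.sum_insert hi]
    exact (h i (by simp)).add hs (ih fun j hj => h j (by simp [hj]))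

lemma lipschitz (hc : Convex ℝ s) (hf : HolderBound α s (m + 1) N f) {x y : Pt n} (hx : x ∈ s)
    (hy : y ∈ s) : |f x - f y| ≤ n * N * ‖x - y‖ := by
  refine hc.norm_image_sub_le_of_norm_fderiv_le (𝕜 := ℝ) (fun z hz => hf.2.2.1 z hz)
    (fun z hz => ?_) hy hx
  refine (clm_norm_le_sum _).trans ?_
  refine (Finset.sum_le_card_nsmul _ _ N fun a _ => (hf.2.2.2 a).bound z hz).trans ?_
  simp

lemma of_succ (hα : α ∈ Ioo (0 : ℝ) 1) (hc : Convex ℝ s) (hf : HolderBound α s (m + 1) N f) :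
    HolderBound α s m ((n + 2) * N) f := by
  have hN := hf.nonneg
  have hle : N ≤ (n + 2) * N := by nlinarith [(Nat.cast_nonneg n : (0 : ℝ) ≤ n)]
  induction m generalizing f with
  | zero =>
    refine ⟨hN.trans hle, fun x hx => (hf.bound x hx).trans hle, fun x hx y hy => ?_⟩
    rcases le_total ‖x - y‖ 1 with h1 | h1
    · have h2 : ‖x - y‖ ≤ ‖x - y‖ ^ α := by
        conv_lhs => rw [← Real.rpow_one ‖x - y‖]
        exact Real.rpow_le_rpow_of_exponent_ge' (norm_nonneg _) h1 hα.1.le hα.2.le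
      have h3 : (0 : ℝ) ≤ n := Nat.cast_nonneg n
      calc |f x - f y| ≤ n * N * ‖x - y‖ := hf.lipschitz hc hx hy
        _ ≤ (n + 2) * N * ‖x - y‖ ^ α := by gcongr; linarith
    · have h2 : 1 ≤ ‖x - y‖ ^ α := Real.one_le_rpow h1 hα.1.le
      have h3 : (0 : ℝ) ≤ n := Nat.cast_nonneg n
      calc |f x - f y| ≤ |f x| + |f y| := abs_sub _ _
        _ ≤ 2 * N * 1 := by linarith [hf.bound x hx, hf.bound y hy]
        _ ≤ (n + 2) * N * ‖x - y‖ ^ α := by gcongr; linarith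
  | succ m ih =>
    exact ⟨hN.trans hle, fun x hx => (hf.bound x hx).trans hle, hf.2.2.1,
      fun a => ih (hf.2.2.2 a)⟩

lemma continuousOn (hα : 0 < α) (hf : HolderBound α s m N f) : ContinuousOn f s := by
  cases m with
  | zero =>
    intro x hx
    rw [ContinuousWithinAt, tendsto_iff_norm_sub_tendsto_zero]
    refine squeeze_zero' (Filter.Eventually.of_forall fun _ => norm_nonneg _)
      (Filter.eventually_of_mem self_mem_nhdsWithin fun y hy => hf.2.2 y hy x hx) ?_
    have : ContinuousAt (fun y : Pt n => N * ‖y - x‖ ^ α) x := by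
      refine ContinuousAt.mul continuousAt_const (ContinuousAt.rpow_const (by fun_prop) (Or.inr hα.le))
    have h2 := this.tendsto
    simp only [sub_self, norm_zero, Real.zero_rpow hα.ne', mul_zero] at h2
    exact h2.mono_left nhdsWithin_le_nhds
  | succ m => exact fun x hx => (hf.2.2.1 x hx).continuousAt.continuousWithinAt

lemma exists_mul (hα : α ∈ Ioo (0 : ℝ) 1) (n m : ℕ) : ∃ C : ℝ, 0 ≤ C ∧
    ∀ (s : Set (Pt n)), IsOpen s → Convex ℝ s → ∀ (N M : ℝ) (f g : Pt n → ℝ),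
      HolderBound α s m N f → HolderBound α s m M g →
        HolderBound α s m (C * (N * M)) (fun x => f x * g x) := by
  induction m with
  | zero =>
    refine ⟨2, by norm_num, fun s hs hc N M f g hf hg => ?_⟩
    have h0 : 0 ≤ N * M := mul_nonneg hf.nonneg hg.nonneg
    refine ⟨by positivity, fun x hx => ?_, fun x hx y hy => ?_⟩
    · rw [abs_mul]
      have := mul_le_mul (hf.bound x hx) (hg.bound x hx) (abs_nonneg _) hf.nonneg
      linarith
    · have e : f x * g x - f y * g y = f x * (g x - g y) + (f x - f y) * g y := by ring
      rw [e]
      refine (abs_add_le _ _).trans ?_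
      rw [abs_mul, abs_mul]
      have h1 := mul_le_mul (hf.bound x hx) (hg.2.2 x hx y hy) (abs_nonneg _) hf.nonneg
      have h2 := mul_le_mul (hf.2.2 x hx y hy) (hg.bound y hy) (abs_nonneg _)
        (mul_nonneg hf.nonneg (by positivity))
      linarith
  | succ m ih =>
    obtain ⟨C, hC, ih⟩ := ih
    refine ⟨2 * C * (n + 2) + 1, by positivity, fun s hs hc N M f g hf hg => ?_⟩
    have h0 : 0 ≤ N * M := mul_nonneg hf.nonneg hg.nonneg
    refine ⟨by positivity, fun x hx => ?_, fun x hx => (hf.2.2.1 x hx).mul (hg.2.2.1 x hx),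
      fun a => ?_⟩
    · rw [abs_mul]
      have := mul_le_mul (hf.bound x hx) (hg.bound x hx) (abs_nonneg _) hf.nonneg
      have h2 : 0 ≤ 2 * C * (n + 2) * (N * M) := by positivity
      linarith
    · have h1 := ih s hs hc _ _ _ _ (hf.2.2.2 a) (hg.of_succ hα hc)
      have h2 := ih s hs hc _ _ _ _ (hf.of_succ hα hc) (hg.2.2.2 a)
      refine ((h1.add hs h2).mono_const ?_).congr hs
        fun x hx => (pd_mul (hf.2.2.1 x hx) (hg.2.2.1 x hx) a).symm
      linarith

lemma of_le (hα : α ∈ Ioo (0 : ℝ) 1) (hc : Convex ℝ s) {m' : ℕ} (hm : m' ≤ m)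
    (hf : HolderBound α s m N f) : HolderBound α s m' ((n + 2) ^ (m - m') * N) f := by
  obtain ⟨d, rfl⟩ := Nat.exists_eq_add_of_le hm
  rw [Nat.add_sub_cancel_left]
  clear hm
  induction d generalizing N with
  | zero => simpa using hf
  | succ d ih =>
    have := ih (hf.of_succ (m := m' + d) hα hc)
    rwa [← mul_assoc, ← pow_succ] at this

lemma comp_smul (hα : α ∈ Ioo (0 : ℝ) 1) {R ρ K : ℝ} (hρ : 0 < ρ) (hK : 1 ≤ K) (hρK : ρ ≤ K)
    (hf : HolderBound α (Metric.ball 0 (ρ * R)) m N f) :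
    HolderBound α (Metric.ball 0 R) m (N * K ^ (m + 1)) (fun x => f (ρ • x)) := by
  have hmem : ∀ x ∈ Metric.ball (0 : Pt n) R, ρ • x ∈ Metric.ball (0 : Pt n) (ρ * R) := by
    intro x hx
    rw [mem_ball_zero_iff] at hx ⊢
    rw [norm_smul, Real.norm_of_nonneg hρ.le]
    exact mul_lt_mul_of_pos_left hx hρ
  have hN := hf.nonneg
  have hle : ∀ j : ℕ, N ≤ N * K ^ j := fun j => le_mul_of_one_le_right hN (one_le_pow₀ hK)
  induction m generalizing f with
  | zero =>
    refine ⟨hN.trans (hle _), fun x hx => (hf.bound _ (hmem x hx)).trans (hle _),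
      fun x hx y hy => (hf.2.2 _ (hmem x hx) _ (hmem y hy)).trans ?_⟩
    rw [← smul_sub, norm_smul, Real.norm_of_nonneg hρ.le, Real.mul_rpow hρ.le (norm_nonneg _),
      ← mul_assoc]
    gcongr
    simp only [zero_add, pow_one]
    calc ρ ^ α ≤ K ^ α := Real.rpow_le_rpow hρ.le hρK hα.1.le
      _ ≤ K ^ (1 : ℝ) := Real.rpow_le_rpow_of_exponent_le hK hα.2.le
      _ = K := Real.rpow_one _
  | succ m ih =>
    refine ⟨hN.trans (hle _), fun x hx => (hf.bound _ (hmem x hx)).trans (hle _),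
      fun x hx => (hf.2.2.1 _ (hmem x hx)).comp x (by fun_prop), fun a => ?_⟩
    refine (((ih (hf.2.2.2 a)).const_mul Metric.isOpen_ball ρ).mono_const ?_).congr
      Metric.isOpen_ball fun x hx => (pd_comp_smul (hf.2.2.1 _ (hmem x hx)) a).symm
    rw [abs_of_pos hρ, pow_succ K (m + 1)]
    have : 0 ≤ N * K ^ (m + 1) := by positivity
    nlinarith

lemma exists_comp_smul_small (hα : α ∈ Ioo (0 : ℝ) 1) {R r : ℝ} (hr : 0 < r) (hR : 1 ≤ R)
    (hf : HolderBound α (Metric.ball 0 r) m N f) (hf0 : f 0 = 0) :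
    ∃ K : ℝ, 0 ≤ K ∧ ∀ ρ, 0 < ρ → ρ ≤ 1 → ρ * R ≤ r →
      HolderBound α (Metric.ball 0 R) m (K * ρ ^ α) (fun x => f (ρ • x)) := by
  have hN := hf.nonneg
  have h0 := (hf.of_le hα (convex_ball 0 r) (Nat.zero_le m))
  set N' := (n + 2 : ℝ) ^ (m - 0) * N with hN'
  have hN0 := h0.nonneg
  have hbd : ∀ ρ, 0 < ρ → ρ ≤ 1 → ρ * R ≤ r → ∀ x ∈ Metric.ball (0 : Pt n) R,
      |f (ρ • x)| ≤ (N' * R + N) * ρ ^ α := by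
    intro ρ hρ hρ1 hρR x hx
    rw [mem_ball_zero_iff] at hx
    have hmem : ρ • x ∈ Metric.ball (0 : Pt n) r := by
      rw [mem_ball_zero_iff, norm_smul, Real.norm_of_nonneg hρ.le]
      exact (mul_lt_mul_of_pos_left hx hρ).trans_le hρR
    have := h0.2.2 _ hmem 0 (Metric.mem_ball_self hr)
    rw [hf0, sub_zero, sub_zero, norm_smul, Real.norm_of_nonneg hρ.le,
      Real.mul_rpow hρ.le (norm_nonneg _)] at this
    have h2 : ‖x‖ ^ α ≤ R := by
      calc ‖x‖ ^ α ≤ R ^ α := Real.rpow_le_rpow (norm_nonneg _) hx.le hα.1.le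
        _ ≤ R ^ (1 : ℝ) := Real.rpow_le_rpow_of_exponent_le hR hα.2.le
        _ = R := Real.rpow_one _
    have h3 : 0 < ρ ^ α := Real.rpow_pos_of_pos hρ _
    calc |f (ρ • x)| ≤ N' * (ρ ^ α * ‖x‖ ^ α) := this
      _ ≤ N' * (ρ ^ α * R) := by gcongr
      _ ≤ (N' * R + N) * ρ ^ α := by nlinarith [mul_nonneg hN h3.le]
  have hK : 0 ≤ N' * R + N := by positivity
  refine ⟨N' * R + N, hK, fun ρ hρ hρ1 hρR => ?_⟩
  have hmem : ∀ x ∈ Metric.ball (0 : Pt n) R, ρ • x ∈ Metric.ball (0 : Pt n) r := by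
    intro x hx
    rw [mem_ball_zero_iff] at hx ⊢
    rw [norm_smul, Real.norm_of_nonneg hρ.le]
    exact (mul_lt_mul_of_pos_left hx hρ).trans_le hρR
  cases m with
  | zero =>
    refine ⟨by positivity, hbd ρ hρ hρ1 hρR, fun x hx y hy =>
      (hf.2.2 _ (hmem x hx) _ (hmem y hy)).trans ?_⟩
    rw [← smul_sub, norm_smul, Real.norm_of_nonneg hρ.le, Real.mul_rpow hρ.le (norm_nonneg _),
      ← mul_assoc]
    gcongr
    nlinarith
  | succ m =>
    refine ⟨by positivity, hbd ρ hρ hρ1 hρR, fun x hx =>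
      (hf.2.2.1 _ (hmem x hx)).comp x (by fun_prop), fun a => ?_⟩
    have h1 : HolderBound α (Metric.ball 0 (ρ * R)) m N (_root_.pd a f) :=
      (hf.2.2.2 a).mono_set (Metric.ball_subset_ball hρR)
    have h2 := (h1.comp_smul hα hρ le_rfl hρ1).const_mul Metric.isOpen_ball ρ
    refine (h2.mono_const ?_).congr Metric.isOpen_ball
      fun x hx => (pd_comp_smul (hf.2.2.1 _ (hmem x hx)) a).symm
    rw [abs_of_pos hρ, one_pow, mul_one, mul_comm]
    have h3 : ρ ≤ ρ ^ α := by
      conv_lhs => rw [← Real.rpow_one ρ]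
      exact Real.rpow_le_rpow_of_exponent_ge hρ hρ1 hα.2.le
    gcongr
    nlinarith

lemma extend (hα : α ∈ Ioo (0 : ℝ) 1) (hf : HolderBound α (Metric.ball 0 3) m N f)
    (h0 : ∀ x ∉ Metric.closedBall (0 : Pt n) 2, f x = 0) : HolderBound α univ m N f := by
  have hN := hf.nonneg
  have hb : ∀ x ∈ (univ : Set (Pt n)), |f x| ≤ N := fun x _ => by
    by_cases hx : x ∈ Metric.ball (0 : Pt n) 3
    · exact hf.bound x hx
    · rw [h0 x fun h => hx (Metric.closedBall_subset_ball (by norm_num) h), abs_zero]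
      exact hN
  induction m generalizing f with
  | zero =>
    have key : ∀ x y : Pt n, x ∈ Metric.closedBall (0 : Pt n) 2 →
        |f x - f y| ≤ N * ‖x - y‖ ^ α := by
      intro x y hx
      by_cases hy : y ∈ Metric.ball (0 : Pt n) 3
      · exact hf.2.2 x (Metric.closedBall_subset_ball (by norm_num) hx) y hy
      · rw [h0 y fun h => hy (Metric.closedBall_subset_ball (by norm_num) h), sub_zero]
        refine (hb x trivial).trans (le_mul_of_one_le_right hN (Real.one_le_rpow ?_ hα.1.le))
        simp only [mem_ball_zero_iff, not_lt, mem_closedBall_zero_iff] at hx hy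
        have := norm_sub_norm_le y x
        rw [norm_sub_rev]
        linarith
    refine ⟨hN, hb, fun x _ y _ => ?_⟩
    by_cases hx : x ∈ Metric.closedBall (0 : Pt n) 2
    · exact key x y hx
    · by_cases hy : y ∈ Metric.closedBall (0 : Pt n) 2
      · rw [abs_sub_comm, norm_sub_rev]; exact key y x hy
      · rw [h0 x hx, h0 y hy, sub_zero, abs_zero]; positivity
  | succ m ih =>
    have hz : EqOn f (fun _ => 0) (Metric.closedBall (0 : Pt n) 2)ᶜ := fun x hx => h0 x hx
    have hpd0 : ∀ a, ∀ x ∉ Metric.closedBall (0 : Pt n) 2, _root_.pd a f x = 0 := fun a x hx => by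
      rw [pd_congr Metric.isClosed_closedBall.isOpen_compl hz a hx, pd_const]
    refine ⟨hN, hb, fun x _ => ?_, fun a => ih (hf.2.2.2 a) (hpd0 a) fun x _ => ?_⟩
    · by_cases hx : x ∈ Metric.ball (0 : Pt n) 3
      · exact hf.2.2.1 x hx
      · have hx' : x ∈ (Metric.closedBall (0 : Pt n) 2)ᶜ :=
          fun h => hx (Metric.closedBall_subset_ball (by norm_num) h)
        exact (differentiableAt_const 0).congr_of_eventuallyEq (Filter.eventuallyEq_of_mem
          (Metric.isClosed_closedBall.isOpen_compl.mem_nhds hx') hz)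
    · by_cases hx : x ∈ Metric.ball (0 : Pt n) 3
      · exact (hf.2.2.2 a).bound x hx
      · rw [hpd0 a x fun h => hx (Metric.closedBall_subset_ball (by norm_num) h), abs_zero]
        exact hN

lemma coord {R : ℝ} (hR : 1 ≤ R) (b : Fin n) :
    HolderBound α (Metric.ball 0 R) (m + 1) R (fun x => x b) := by
  refine ⟨by linarith, fun x hx => ?_, fun x _ => by fun_prop, fun a => ?_⟩
  · rw [mem_ball_zero_iff] at hx
    exact (norm_le_pi_norm x b).trans hx.le
  · rw [pd_coord]
    refine (HolderBound.const _).mono_const ?_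
    split_ifs <;> simp <;> linarith

lemma tsum {F : ℕ → Pt n → ℝ} {B : ℕ → ℝ} (hB : Summable B)
    (hF : ∀ i, HolderBound α univ m (B i) (F i)) :
    HolderBound α univ m (∑' i, B i) (fun x => ∑' i, F i x) := by
  have hB0 : 0 ≤ ∑' i, B i := tsum_nonneg fun i => (hF i).nonneg
  have hsum : ∀ x, Summable fun i => F i x := fun x =>
    Summable.of_norm_bounded hB fun i => (hF i).bound x trivial
  have hbd : ∀ x ∈ (univ : Set (Pt n)), |∑' i, F i x| ≤ ∑' i, B i := fun x _ => by
    rw [← Real.norm_eq_abs]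
    exact tsum_of_norm_bounded hB.hasSum fun i => (hF i).bound x trivial
  induction m generalizing F with
  | zero =>
    refine ⟨hB0, hbd, fun x _ y _ => ?_⟩
    rw [← (hsum x).tsum_sub (hsum y), ← tsum_mul_right, ← Real.norm_eq_abs]
    exact tsum_of_norm_bounded (hB.mul_right _).hasSum fun i => (hF i).2.2 x trivial y trivial
  | succ m ih =>
    have hu : Summable fun i => (n : ℝ) * B i := hB.mul_left _
    have hd : ∀ i, Differentiable ℝ (F i) := fun i x => (hF i).2.2.1 x trivial
    have hu' : ∀ i x, ‖fderiv ℝ (F i) x‖ ≤ n * B i := fun i x => by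
      refine (clm_norm_le_sum _).trans ?_
      refine (Finset.sum_le_card_nsmul _ _ (B i) fun a _ =>
        ((hF i).2.2.2 a).bound x trivial).trans ?_
      simp
    have hpd : ∀ a x, _root_.pd a (fun x => ∑' i, F i x) x = ∑' i, _root_.pd a (F i) x := by
      intro a x
      have hs : Summable fun i => fderiv ℝ (F i) x :=
        Summable.of_norm_bounded hu fun i => hu' i x
      simp only [_root_.pd]
      rw [fderiv_tsum_apply hu hd hu' (hsum 0) x]
      exact (ContinuousLinearMap.apply ℝ ℝ (Pi.single a (1 : ℝ) : Pt n)).map_tsum hs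
    refine ⟨hB0, hbd, fun x _ => ?_, fun a => ?_⟩
    · exact differentiable_tsum hu (fun i x => (hd i x).hasFDerivAt) hu' x
    · refine (ih (fun i => (hF i).2.2.2 a) (fun x => ?_) fun x _ => ?_).congr isOpen_univ
        fun x _ => (hpd a x).symm
      · exact Summable.of_norm_bounded hB fun i => ((hF i).2.2.2 a).bound x trivial
      · rw [← Real.norm_eq_abs]
        exact tsum_of_norm_bounded hB.hasSum fun i => ((hF i).2.2.2 a).bound x trivial

lemma exists_of_hasCompactSupport (hα : α ∈ Ioo (0 : ℝ) 1) (hf : ContDiff ℝ (⊤ : ℕ∞) f)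
    (hc : HasCompactSupport f) (m : ℕ) : ∃ N, HolderBound α univ m N f := by
  have key : ∀ (m : ℕ) (f : Pt n → ℝ), ContDiff ℝ (⊤ : ℕ∞) f → HasCompactSupport f →
      ∃ N, HolderBound α univ (m + 1) N f := by
    have hpdc : ∀ (f : Pt n → ℝ), ContDiff ℝ (⊤ : ℕ∞) f → HasCompactSupport f → ∀ a,
        ContDiff ℝ (⊤ : ℕ∞) (_root_.pd a f) ∧ HasCompactSupport (_root_.pd a f) := by
      intro f hf hc a
      exact ⟨(hf.fderiv_right (by simp)).clm_apply contDiff_const, hc.fderiv_apply ℝ _⟩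
    have hbdd : ∀ (f : Pt n → ℝ), ContDiff ℝ (⊤ : ℕ∞) f → HasCompactSupport f →
        ∃ N, 0 ≤ N ∧ ∀ x, |f x| ≤ N := by
      intro f hf hc
      obtain ⟨N, hN⟩ := hc.exists_bound_of_continuous hf.continuous
      exact ⟨N, (norm_nonneg _).trans (hN 0), hN⟩
    intro m
    induction m with
    | zero =>
      intro f hf hc
      obtain ⟨N, hN0, hN⟩ := hbdd f hf hc
      have h0 : ∀ g : Pt n → ℝ, ContDiff ℝ (⊤ : ℕ∞) g → HasCompactSupport g →
          ∃ N, HolderBound α univ 0 N g := by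
        intro g hg hgc
        obtain ⟨C, hC⟩ := hg.lipschitzWith_of_hasCompactSupport hgc (by simp)
        obtain ⟨N, hN0, hN⟩ := hbdd g hg hgc
        refine ⟨C + 2 * N, by positivity, fun x _ => (hN x).trans (by linarith [C.2]), ?_⟩
        intro x _ y _
        have hCn : (0 : ℝ) ≤ C := C.2
        rcases le_total ‖x - y‖ 1 with h1 | h1
        · have h2 : ‖x - y‖ ≤ ‖x - y‖ ^ α := by
            conv_lhs => rw [← Real.rpow_one ‖x - y‖]
            exact Real.rpow_le_rpow_of_exponent_ge' (norm_nonneg _) h1 hα.1.le hα.2.le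
          calc |g x - g y| ≤ C * ‖x - y‖ := by
                simpa [Real.dist_eq, dist_eq_norm] using hC.dist_le_mul x y
            _ ≤ (C + 2 * N) * ‖x - y‖ ^ α := by gcongr; linarith
        · have h2 : 1 ≤ ‖x - y‖ ^ α := Real.one_le_rpow h1 hα.1.le
          calc |g x - g y| ≤ |g x| + |g y| := abs_sub _ _
            _ ≤ 2 * N * 1 := by linarith [hN x, hN y]
            _ ≤ (C + 2 * N) * ‖x - y‖ ^ α := by gcongr; linarith
      choose B hB using fun a => h0 _ (hpdc f hf hc a).1 (hpdc f hf hc a).2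
      have hBn : 0 ≤ ∑ a, B a := Finset.sum_nonneg fun a _ => (hB a).nonneg
      refine ⟨N + ∑ a, B a, by positivity, fun x _ => (hN x).trans (by linarith),
        fun x _ => (hf.differentiable (by simp)) x, fun a => (hB a).mono_const ?_⟩
      have := Finset.single_le_sum (f := B) (fun a _ => (hB a).nonneg) (Finset.mem_univ a)
      linarith
    | succ m ih =>
      intro f hf hc
      obtain ⟨N, hN0, hN⟩ := hbdd f hf hc
      choose B hB using fun a => ih _ (hpdc f hf hc a).1 (hpdc f hf hc a).2
      have hBn : 0 ≤ ∑ a, B a := Finset.sum_nonneg fun a _ => (hB a).nonneg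
      refine ⟨N + ∑ a, B a, by positivity, fun x _ => (hN x).trans (by linarith),
        fun x _ => (hf.differentiable (by simp)) x, fun a => (hB a).mono_const ?_⟩
      have := Finset.single_le_sum (f := B) (fun a _ => (hB a).nonneg) (Finset.mem_univ a)
      linarith
  obtain ⟨N, hN⟩ := key m f hf hc
  exact ⟨_, hN.of_succ hα convex_univ⟩

end HolderBound

/-! ### Averages against rescaled test functions -/

/-- Smooth functions with compact support. -/
def IsTest {n : ℕ} (η : Pt n → ℝ) : Prop := ContDiff ℝ (⊤ : ℕ∞) η ∧ HasCompactSupport η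

/-- The average of `f` at `x` and scale `s` with weight `η`. -/
def avg {n : ℕ} (η f : Pt n → ℝ) (s : ℝ) (x : Pt n) : ℝ :=
  ∫ z, η z * f (x - s • z)

/-- The divergence of the vector field `z ↦ η z • z`. -/
def dilation {n : ℕ} (η : Pt n → ℝ) (z : Pt n) : ℝ := n * η z + fderiv ℝ η z z

namespace IsTest

variable {n : ℕ} {η : Pt n → ℝ}

lemma pd (h : IsTest η) (a : Fin n) : IsTest (pd a η) :=
  ⟨(h.1.fderiv_right (by simp)).clm_apply contDiff_const, h.2.fderiv_apply ℝ _⟩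

lemma differentiable (h : IsTest η) : Differentiable ℝ η := h.1.differentiable (by simp)

lemma dilation (h : IsTest η) : IsTest (dilation η) := by
  refine ⟨(contDiff_const.mul h.1).add ((h.1.fderiv_right (by simp)).clm_apply contDiff_id), ?_⟩
  refine (h.2.mul_left (f := fun _ => (n : ℝ))).add (h.2.fderiv ℝ |>.mono fun z hz => ?_)
  contrapose! hz
  simp only [Function.mem_support, not_not] at hz ⊢
  rw [hz]; rfl

lemma integrable_mul (h : IsTest η) {f : Pt n → ℝ} (hf : Continuous f) :
    MeasureTheory.Integrable (fun z => η z * f z) :=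
  (h.1.continuous.mul hf).integrable_of_hasCompactSupport h.2.mul_right

lemma integrable (h : IsTest η) : MeasureTheory.Integrable η :=
  h.1.continuous.integrable_of_hasCompactSupport h.2

lemma integral_mul_pd (h : IsTest η) {f : Pt n → ℝ} (hf : Differentiable ℝ f)
    (a : Fin n) (hf' : Continuous (_root_.pd a f)) :
    ∫ z, η z * _root_.pd a f z = -∫ z, _root_.pd a η z * f z :=
  integral_mul_fderiv_eq_neg_fderiv_mul_of_integrable ((h.pd a).integrable_mul hf.continuous)
    (h.integrable_mul hf') (h.integrable_mul hf.continuous)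
    (fun x _ => h.differentiable x) fun x _ => hf x

lemma integral_pd (h : IsTest η) (a : Fin n) : ∫ z, _root_.pd a η z = 0 := by
  have := h.integral_mul_pd (f := fun _ => 1) (by fun_prop) a (by rw [pd_const]; fun_prop)
  rw [pd_const] at this
  simpa using this

end IsTest

section

variable {n : ℕ} {η f : Pt n → ℝ}

lemma avg_eq_convolution (η f : Pt n → ℝ) {s : ℝ} (hs : 0 < s) (x : Pt n) :
    avg η f s x = MeasureTheory.convolution f (fun y => (s ^ n)⁻¹ * η (s⁻¹ • y))
      (ContinuousLinearMap.mul ℝ ℝ) MeasureTheory.volume x := by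
  rw [MeasureTheory.convolution_mul_swap]
  have h := MeasureTheory.Measure.integral_comp_smul (MeasureTheory.volume : MeasureTheory.Measure (Pt n))
    (fun z => η z * f (x - s • z)) s⁻¹
  simp only [smul_inv_smul₀ hs.ne', Module.finrank_pi, Fintype.card_fin, smul_eq_mul] at h
  have h2 : ∀ t : Pt n, f (x - t) * ((s ^ n)⁻¹ * η (s⁻¹ • t)) =
      (s ^ n)⁻¹ * (η (s⁻¹ • t) * f (x - t)) := fun t => by ring
  simp_rw [h2]
  rw [MeasureTheory.integral_const_mul, h, inv_pow, inv_inv, abs_of_pos (pow_pos hs n), avg,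
    ← mul_assoc, inv_mul_cancel₀ (pow_pos hs n).ne', one_mul]

lemma hasFDerivAt_scaled_kernel (hη : IsTest η) {s : ℝ} (hs : 0 < s) (y : Pt n) :
    HasFDerivAt (fun p : ℝ × Pt n => (p.1 ^ n)⁻¹ * η (p.1⁻¹ • p.2))
      ((s⁻¹ * (s ^ n)⁻¹) • ((fderiv ℝ η (s⁻¹ • y)).comp (ContinuousLinearMap.snd ℝ ℝ (Pt n))
        - dilation η (s⁻¹ • y) • ContinuousLinearMap.fst ℝ ℝ (Pt n))) (s, y) := by
  have h1 : HasFDerivAt (fun p : ℝ × Pt n => p.1⁻¹)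
      ((-(s ^ 2)⁻¹) • ContinuousLinearMap.fst ℝ ℝ (Pt n)) (s, y) :=
    (hasDerivAt_inv hs.ne').comp_hasFDerivAt (s, y) hasFDerivAt_fst
  have h2 : HasFDerivAt (fun p : ℝ × Pt n => (p.1 ^ n)⁻¹)
      ((-(n * (s⁻¹ * (s ^ n)⁻¹))) • ContinuousLinearMap.fst ℝ ℝ (Pt n)) (s, y) := by
    have : HasDerivAt (fun t : ℝ => (t ^ n)⁻¹) (-(n * (s⁻¹ * (s ^ n)⁻¹))) s := by
      refine ((hasDerivAt_pow n s).inv (pow_pos hs n).ne').congr_deriv ?_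
      rcases n with _ | k
      · simp
      · simp only [Nat.add_sub_cancel]; field_simp; ring
    exact this.comp_hasFDerivAt (f := fun p : ℝ × Pt n => p.1) (s, y) hasFDerivAt_fst
  have h3 : HasFDerivAt (fun p : ℝ × Pt n => η (p.1⁻¹ • p.2)) _ (s, y) :=
    (hη.differentiable (s⁻¹ • y)).hasFDerivAt.comp (s, y) (h1.smul hasFDerivAt_snd)
  refine (h2.mul h3).congr_fderiv ?_
  ext
  · simp [dilation]
    field_simp
  · simp
    ring

lemma exists_hasFDerivAt_avg (hη : IsTest η) (hf : Continuous f) {s : ℝ} (hs : 0 < s) (x : Pt n) :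
    ∃ L : ℝ × Pt n →L[ℝ] ℝ, HasFDerivAt (fun q : ℝ × Pt n => avg η f q.1 q.2) L (s, x) ∧
      (∀ v : Pt n, L (0, v) = s⁻¹ * avg (fun z => fderiv ℝ η z v) f s x) ∧
      L (1, 0) = -(s⁻¹ * avg (dilation η) f s x) := by
  set g : ℝ → Pt n → ℝ := fun t y => (t ^ n)⁻¹ * η (t⁻¹ • y) with hg
  obtain ⟨R, hR0, hR⟩ : ∃ R, 0 < R ∧ ∀ z : Pt n, R < ‖z‖ → η z = 0 := by
    obtain ⟨R, hR⟩ := hη.2.isCompact.isBounded.subset_closedBall (0 : Pt n)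
    refine ⟨max R 1, by positivity, fun z hz => image_eq_zero_of_notMem_tsupport fun h => ?_⟩
    have := hR h
    rw [mem_closedBall_zero_iff] at this
    exact absurd (hz.trans_le this) (not_lt.mpr (le_max_left _ _))
  have hsupp : ∀ p, ∀ y : Pt n, p ∈ Ioo 0 (2 * s) → y ∉ Metric.closedBall (0 : Pt n) (2 * s * R) →
      g p y = 0 := by
    intro p y hp hy
    rw [mem_closedBall_zero_iff, not_le] at hy
    have : η (p⁻¹ • y) = 0 := hR _ (by
      rw [norm_smul, norm_inv, Real.norm_of_nonneg hp.1.le, lt_inv_mul_iff₀ hp.1]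
      refine lt_of_le_of_lt ?_ hy
      exact mul_le_mul_of_nonneg_right hp.2.le hR0.le)
    simp [hg, this]
  have hsmooth : ContDiffOn ℝ 1 (Function.uncurry g) (Ioo 0 (2 * s) ×ˢ univ) := by
    have h1 : ContDiffOn ℝ 1 (fun p : ℝ × Pt n => p.1⁻¹) (Ioo 0 (2 * s) ×ˢ univ) :=
      contDiffOn_fst.inv fun p hp => hp.1.1.ne'
    have h2 : ContDiffOn ℝ 1 (fun p : ℝ × Pt n => (p.1 ^ n)⁻¹) (Ioo 0 (2 * s) ×ˢ univ) :=
      (contDiffOn_fst.pow n).inv fun p hp => (pow_pos hp.1.1 n).ne'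
    exact h2.mul ((hη.1.of_le (by exact_mod_cast le_top)).comp_contDiffOn (h1.smul contDiffOn_snd))
  have hmem : s ∈ Ioo 0 (2 * s) := ⟨hs, by linarith⟩
  have key := MeasureTheory.hasFDerivAt_convolution_right_with_param
    (ContinuousLinearMap.mul ℝ ℝ) (μ := MeasureTheory.volume) isOpen_Ioo
    (isCompact_closedBall (0 : Pt n) (2 * s * R)) hsupp hf.locallyIntegrable hsmooth (s, x) hmem
  have hfd : (fun y : Pt n => fderiv ℝ (Function.uncurry g) (s, y)) = fun y =>
      (s⁻¹ * (s ^ n)⁻¹) • ((fderiv ℝ η (s⁻¹ • y)).comp (ContinuousLinearMap.snd ℝ ℝ (Pt n))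
        - dilation η (s⁻¹ • y) • ContinuousLinearMap.fst ℝ ℝ (Pt n)) := by
    ext1 y
    exact (hasFDerivAt_scaled_kernel hη hs y).fderiv
  have hcont : Continuous fun y : Pt n => fderiv ℝ (Function.uncurry g) (s, y) := by
    rw [hfd]
    have h1 : Continuous (fderiv ℝ η) := hη.1.continuous_fderiv (by simp)
    have h2 : Continuous (dilation η) := hη.dilation.1.continuous
    have h3 : Continuous fun y : Pt n => s⁻¹ • y := by fun_prop
    exact Continuous.const_smul (((h1.comp h3).clm_comp (continuous_const (y := ContinuousLinearMap.snd ℝ ℝ (Pt n)))).sub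
      ((h2.comp h3).smul (continuous_const (y := ContinuousLinearMap.fst ℝ ℝ (Pt n))))) (s⁻¹ * (s ^ n)⁻¹)
  have hcomp : HasCompactSupport fun y : Pt n => fderiv ℝ (Function.uncurry g) (s, y) := by
    refine HasCompactSupport.of_support_subset_isCompact
      (isCompact_closedBall (0 : Pt n) (s * R)) fun y hy => ?_
    contrapose! hy
    rw [mem_closedBall_zero_iff, not_le] at hy
    have hz : s⁻¹ • y ∈ (Metric.closedBall (0 : Pt n) R)ᶜ := by
      rw [mem_compl_iff, mem_closedBall_zero_iff, not_le, norm_smul, norm_inv,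
        Real.norm_of_nonneg hs.le, lt_inv_mul_iff₀ hs]
      exact hy
    have hz0 : EqOn η (fun _ => 0) (Metric.closedBall (0 : Pt n) R)ᶜ := fun z hz => hR z (by
      rwa [mem_compl_iff, mem_closedBall_zero_iff, not_le] at hz)
    have e1 : fderiv ℝ η (s⁻¹ • y) = 0 := by
      rw [Filter.EventuallyEq.fderiv_eq (Filter.eventuallyEq_of_mem
        (Metric.isClosed_closedBall.isOpen_compl.mem_nhds hz) hz0)]
      simp
    rw [Function.mem_support, not_not, congrFun hfd y, dilation, e1, hz0 hz]
    simp
  have happ := fun v : ℝ × Pt n => MeasureTheory.convolution_precompR_apply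
    (ContinuousLinearMap.mul ℝ ℝ) (μ := MeasureTheory.volume) hf.locallyIntegrable hcomp hcont x v
  refine ⟨_, key.congr_of_eventuallyEq ?_, fun v => ?_, ?_⟩
  · have : ∀ᶠ q : ℝ × Pt n in nhds (s, x), 0 < q.1 :=
      continuous_fst.continuousAt.eventually (lt_mem_nhds hs)
    exact this.mono fun q hq => avg_eq_convolution η f hq q.2
  · refine (happ (0, v)).trans ?_
    rw [avg_eq_convolution _ f hs, MeasureTheory.convolution_def, MeasureTheory.convolution_def,
      ← MeasureTheory.integral_const_mul]
    refine MeasureTheory.integral_congr_ae (Filter.Eventually.of_forall fun t => ?_)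
    simp only [congrFun hfd, ContinuousLinearMap.mul_apply']
    simp
    ring
  · refine (happ (1, 0)).trans ?_
    rw [avg_eq_convolution _ f hs, MeasureTheory.convolution_def, MeasureTheory.convolution_def,
      ← MeasureTheory.integral_const_mul, ← MeasureTheory.integral_neg]
    refine MeasureTheory.integral_congr_ae (Filter.Eventually.of_forall fun t => ?_)
    simp only [congrFun hfd, ContinuousLinearMap.mul_apply']
    simp
    ring

lemma differentiable_avg (hη : IsTest η) (hf : Continuous f) {s : ℝ} (hs : 0 < s) :
    Differentiable ℝ (avg η f s) := fun x => by
  obtain ⟨L, hL, -, -⟩ := exists_hasFDerivAt_avg hη hf hs x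
  exact (hL.comp x ((hasFDerivAt_const s x).prodMk (hasFDerivAt_id x))).differentiableAt

lemma pd_avg (hη : IsTest η) (hf : Continuous f) {s : ℝ} (hs : 0 < s) (a : Fin n) (x : Pt n) :
    pd a (avg η f s) x = s⁻¹ * avg (pd a η) f s x := by
  obtain ⟨L, hL, h1, -⟩ := exists_hasFDerivAt_avg hη hf hs x
  have h2 : HasFDerivAt (avg η f s) _ x :=
    hL.comp x ((hasFDerivAt_const s x).prodMk (hasFDerivAt_id x))
  rw [pd, h2.fderiv]
  exact h1 _

lemma hasDerivAt_avg (hη : IsTest η) (hf : Continuous f) {s : ℝ} (hs : 0 < s) (x : Pt n) :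
    HasDerivAt (fun t => avg η f t x) (-(s⁻¹ * avg (dilation η) f s x)) s := by
  obtain ⟨L, hL, -, h1⟩ := exists_hasFDerivAt_avg hη hf hs x
  rw [← h1]
  exact hL.comp_hasDerivAt s ((hasDerivAt_id s).prodMk (hasDerivAt_const s x))

lemma continuousOn_avg (hη : IsTest η) (hf : Continuous f) (x : Pt n) :
    ContinuousOn (fun t => avg η f t x) (Ioi 0) := fun _ hs =>
  (hasDerivAt_avg hη hf hs x).continuousAt.continuousWithinAt

lemma integrable_avg (hη : IsTest η) (hf : Continuous f) (s : ℝ) (x : Pt n) :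
    MeasureTheory.Integrable fun z => η z * f (x - s • z) :=
  hη.integrable_mul (f := fun z => f (x - s • z)) (by fun_prop)

lemma avg_pd_comm (hη : IsTest η) (hf : Differentiable ℝ f) (a : Fin n) (hf' : Continuous (pd a f))
    {s : ℝ} (hs : 0 < s) (x : Pt n) :
    avg η (pd a f) s x = s⁻¹ * avg (pd a η) f s x := by
  have hF : ∀ z : Pt n, HasFDerivAt (fun z : Pt n => f (x - s • z))
      ((fderiv ℝ f (x - s • z)).comp (-(s • ContinuousLinearMap.id ℝ (Pt n)))) z := fun z =>
    (hf _).hasFDerivAt.comp z (((hasFDerivAt_id z).const_smul s).const_sub x)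
  have hpd : pd a (fun z : Pt n => f (x - s • z)) = fun z => -s * pd a f (x - s • z) := by
    ext z
    rw [pd, (hF z).fderiv]
    simp [pd]
  have := hη.integral_mul_pd (f := fun z => f (x - s • z)) (fun z => (hF z).differentiableAt) a
    (by rw [hpd]; fun_prop)
  rw [hpd] at this
  have e : ∀ z, η z * (-s * pd a f (x - s • z)) = -s * (η z * pd a f (x - s • z)) :=
    fun z => by ring
  simp only [e] at this
  rw [MeasureTheory.integral_const_mul] at this
  rw [avg, avg, eq_inv_mul_iff_mul_eq₀ hs.ne']
  linarith

/-- The `α`-moment of a test function. -/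
def moment {n : ℕ} (α : ℝ) (η : Pt n → ℝ) : ℝ := ∫ z, |η z| * ‖z‖ ^ α

lemma moment_nonneg (α : ℝ) (η : Pt n → ℝ) : 0 ≤ moment α η :=
  MeasureTheory.integral_nonneg fun z => by positivity

lemma abs_avg_le {N : ℝ} (hη : IsTest η) (hf : ∀ x, |f x| ≤ N) (s : ℝ)
    (x : Pt n) : |avg η f s x| ≤ N * ∫ z, |η z| := by
  rw [← MeasureTheory.integral_const_mul, ← Real.norm_eq_abs]
  refine MeasureTheory.norm_integral_le_of_norm_le (hη.integrable.abs.const_mul N)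
    (Filter.Eventually.of_forall fun z => ?_)
  rw [norm_mul, mul_comm]
  exact mul_le_mul_of_nonneg_right (hf _) (abs_nonneg _)

lemma abs_avg_sub_le {α N : ℝ} (hα : 0 < α) (hη : IsTest η) (hf : HolderBound α univ 0 N f)
    {s : ℝ} (hs : 0 < s) (x : Pt n) :
    |avg η f s x - (∫ z, η z) * f x| ≤ N * moment α η * s ^ α := by
  have hfc : Continuous f := continuousOn_univ.mp (hf.continuousOn hα)
  have hInt : MeasureTheory.Integrable fun z => |η z| * ‖z‖ ^ α := by
    have : Continuous fun z : Pt n => ‖z‖ ^ α :=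
      continuous_norm.rpow_const fun _ => Or.inr hα.le
    exact ((hη.integrable_mul this).norm).congr (Filter.Eventually.of_forall fun z => by
      simp only [norm_mul, Real.norm_eq_abs]
      rw [abs_of_nonneg (by positivity : 0 ≤ ‖z‖ ^ α)])
  rw [avg, ← MeasureTheory.integral_mul_const, ← MeasureTheory.integral_sub
    (integrable_avg hη hfc s x) (hη.integrable.mul_const _), moment,
    ← MeasureTheory.integral_const_mul, ← MeasureTheory.integral_mul_const, ← Real.norm_eq_abs]
  refine MeasureTheory.norm_integral_le_of_norm_le ((hInt.const_mul N).mul_const _)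
    (Filter.Eventually.of_forall fun z => ?_)
  rw [← mul_sub, norm_mul]
  have := hf.2.2 (x - s • z) trivial x trivial
  rw [sub_sub_cancel_left, norm_neg, norm_smul, Real.norm_of_nonneg hs.le,
    Real.mul_rpow hs.le (norm_nonneg _)] at this
  calc ‖η z‖ * ‖f (x - s • z) - f x‖ ≤ |η z| * (N * (s ^ α * ‖z‖ ^ α)) :=
        mul_le_mul_of_nonneg_left this (abs_nonneg _)
    _ = _ := by ring

end

/-! ### Truncated potentials -/

/-- The superposition of the averages of `f` over the scales `0 < s ≤ S` with density `s ^ p`. -/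
def pot {n : ℕ} (η f : Pt n → ℝ) (p S : ℝ) (x : Pt n) : ℝ :=
  ∫ s in Ioc 0 S, s ^ p * avg η f s x

section

variable {n : ℕ} {η f g : Pt n → ℝ} {α N p S : ℝ}

lemma integrableOn_rpow_Ioc {r : ℝ} (hr : -1 < r) (S : ℝ) :
    MeasureTheory.IntegrableOn (fun s : ℝ => s ^ r) (Ioc 0 S) := by
  rcases le_total 0 S with h | h
  · exact (intervalIntegrable_iff_integrableOn_Ioc_of_le h).mp
      (intervalIntegral.intervalIntegrable_rpow' hr)
  · simp [Ioc_eq_empty (not_lt.mpr h)]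

lemma aestronglyMeasurable_pot (hη : IsTest η) (hf : Continuous f) (p S : ℝ) (x : Pt n) :
    MeasureTheory.AEStronglyMeasurable (fun s => s ^ p * avg η f s x)
      (MeasureTheory.volume.restrict (Ioc 0 S)) := by
  refine ContinuousOn.aestronglyMeasurable (ContinuousOn.mul (fun s hs => ?_)
    ((continuousOn_avg hη hf x).mono fun s hs => hs.1)) measurableSet_Ioc
  exact (Real.continuousAt_rpow_const s p (Or.inl hs.1.ne')).continuousWithinAt

lemma integrableOn_pot (hη : IsTest η) (hf : Continuous f) {K β : ℝ} (hp : -1 < p + β) {x : Pt n}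
    (hK : ∀ s, 0 < s → |avg η f s x| ≤ K * s ^ β) :
    MeasureTheory.IntegrableOn (fun s => s ^ p * avg η f s x) (Ioc 0 S) := by
  refine ((integrableOn_rpow_Ioc hp S).const_mul K).mono' (aestronglyMeasurable_pot hη hf p S x) ?_
  refine (MeasureTheory.ae_restrict_mem measurableSet_Ioc).mono fun s hs => ?_
  have h1 : 0 < s ^ p := Real.rpow_pos_of_pos hs.1 p
  rw [norm_mul, Real.norm_of_nonneg h1.le, Real.rpow_add hs.1]
  calc s ^ p * ‖avg η f s x‖ ≤ s ^ p * (K * s ^ β) :=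
        mul_le_mul_of_nonneg_left (hK s hs.1) h1.le
    _ = _ := by ring

lemma integrableOn_pot_of_bound (hη : IsTest η) (hfc : Continuous f) (hf : ∀ x, |f x| ≤ N)
    (hp : -1 < p) (x : Pt n) :
    MeasureTheory.IntegrableOn (fun s => s ^ p * avg η f s x) (Ioc 0 S) :=
  integrableOn_pot hη hfc (β := 0) (K := N * ∫ z, |η z|) (by linarith) fun s _ => by
    simpa using abs_avg_le hη hf s x

lemma abs_avg_le_of_integral_eq_zero (hα : α ∈ Ioo (0 : ℝ) 1) (hη : IsTest η)
    (h0 : ∫ z, η z = 0) (hf : HolderBound α univ 0 N f) {s : ℝ} (hs : 0 < s) (x : Pt n) :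
    |avg η f s x| ≤ N * moment α η * s ^ α := by
  simpa [h0] using abs_avg_sub_le hα.1 hη hf hs x

lemma integrableOn_pot_of_integral_eq_zero (hα : α ∈ Ioo (0 : ℝ) 1) (hη : IsTest η)
    (h0 : ∫ z, η z = 0) (hf : HolderBound α univ 0 N f) (hp : -1 < p + α) (x : Pt n) :
    MeasureTheory.IntegrableOn (fun s => s ^ p * avg η f s x) (Ioc 0 S) :=
  integrableOn_pot hη (continuousOn_univ.mp (hf.continuousOn hα.1)) hp
    fun _ hs => abs_avg_le_of_integral_eq_zero hα hη h0 hf hs x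

lemma abs_pot_le (hη : IsTest η) (hf : ∀ x, |f x| ≤ N) (hp : 0 ≤ p) (hS : 0 ≤ S) (x : Pt n) :
    |pot η f p S x| ≤ (S ^ p * (∫ z, |η z|) * S) * N := by
  have hN : 0 ≤ N := (abs_nonneg _).trans (hf x)
  have hI : 0 ≤ ∫ z, |η z| := MeasureTheory.integral_nonneg fun z => abs_nonneg _
  have := MeasureTheory.norm_setIntegral_le_of_norm_le_const (μ := MeasureTheory.volume)
    (s := Ioc 0 S) (f := fun s => s ^ p * avg η f s x) (C := S ^ p * (N * ∫ z, |η z|)) (by simp)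
    fun s hs => by
      rw [norm_mul, Real.norm_of_nonneg (Real.rpow_nonneg hs.1.le p)]
      exact mul_le_mul (Real.rpow_le_rpow hs.1.le hs.2 hp) (abs_avg_le hη hf s x)
        (norm_nonneg _) (Real.rpow_nonneg hS p)
  rw [Real.volume_real_Ioc_of_le hS, sub_zero] at this
  refine this.trans (le_of_eq (by ring))

lemma abs_pot_le_of_integral_eq_zero (hα : α ∈ Ioo (0 : ℝ) 1) (hη : IsTest η)
    (h0 : ∫ z, η z = 0) (hf : HolderBound α univ 0 N f) (hp : -1 < p + α) (x : Pt n) :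
    |pot η f p S x| ≤ (moment α η * ∫ s in Ioc 0 S, s ^ (p + α)) * N := by
  rw [pot, ← Real.norm_eq_abs]
  refine (MeasureTheory.norm_integral_le_of_norm_le
    ((integrableOn_rpow_Ioc hp S).const_mul (N * moment α η)) ?_).trans (le_of_eq ?_)
  · refine (MeasureTheory.ae_restrict_mem measurableSet_Ioc).mono fun s hs => ?_
    have h1 : 0 < s ^ p := Real.rpow_pos_of_pos hs.1 p
    rw [norm_mul, Real.norm_of_nonneg h1.le, Real.rpow_add hs.1]
    calc s ^ p * ‖avg η f s x‖ ≤ s ^ p * (N * moment α η * s ^ α) := mul_le_mul_of_nonneg_left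
          (abs_avg_le_of_integral_eq_zero hα hη h0 hf hs.1 x) h1.le
      _ = _ := by ring
  · rw [MeasureTheory.integral_const_mul]; ring

lemma hasFDerivAt_pot (hα : α ∈ Ioo (0 : ℝ) 1) (hη : IsTest η) (hf : HolderBound α univ 0 N f)
    (hp : 0 ≤ p) (x : Pt n) :
    HasFDerivAt (pot η f p S) (∑ a, pot (pd a η) f (p - 1) S x •
      ContinuousLinearMap.proj (R := ℝ) (φ := fun _ : Fin n => ℝ) a) x := by
  have hfc : Continuous f := continuousOn_univ.mp (hf.continuousOn hα.1)
  have hp' : -1 < p - 1 + α := by linarith [hα.1]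
  obtain ⟨P, hP⟩ : ∃ P : Fin n → (Pt n →L[ℝ] ℝ), ∀ a, P a =
      ContinuousLinearMap.proj (R := ℝ) (φ := fun _ : Fin n => ℝ) a := ⟨_, fun _ => rfl⟩
  obtain ⟨F', hF'⟩ : ∃ F' : Pt n → ℝ → (Pt n →L[ℝ] ℝ), F' = fun y s =>
      ∑ a, (s ^ (p - 1) * avg (pd a η) f s y) • P a := ⟨_, rfl⟩
  simp only [← hP]
  have happ : ∀ y s a, F' y s (Pi.single a 1) = s ^ (p - 1) * avg (pd a η) f s y := by
    intro y s a
    simp [hF', hP, Pi.single_apply]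
  have hInt : ∀ a, MeasureTheory.IntegrableOn (fun s => s ^ (p - 1) * avg (pd a η) f s x) (Ioc 0 S) :=
    fun a => integrableOn_pot_of_integral_eq_zero hα (hη.pd a) (hη.integral_pd a) hf hp' x
  have heq : ∫ s in Ioc 0 S, F' x s = ∑ a, pot (pd a η) f (p - 1) S x • P a := by
    simp only [hF']
    rw [MeasureTheory.integral_finsetSum _ fun a _ => (hInt a).smul_const _]
    refine Finset.sum_congr rfl fun a _ => ?_
    rw [integral_smul_const]
    rfl
  rw [← heq]
  refine hasFDerivAt_integral_of_dominated_of_fderiv_le (s := univ)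
    (μ := MeasureTheory.volume.restrict (Ioc 0 S)) (F := fun y s => s ^ p * avg η f s y) (F' := F')
    (bound := fun s => (∑ a, N * moment α (pd a η)) * s ^ (p - 1 + α)) Filter.univ_mem
    (Filter.Eventually.of_forall fun y => aestronglyMeasurable_pot hη hfc p S y)
    (integrableOn_pot_of_bound hη hfc (fun y => hf.bound y trivial) (by linarith) x)
    ?_ ?_ ((integrableOn_rpow_Ioc hp' S).const_mul _) ?_
  · have hsm : ∀ a, MeasureTheory.AEStronglyMeasurable
        (fun s => (s ^ (p - 1) * avg (pd a η) f s x) • P a)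
        (MeasureTheory.volume.restrict (Ioc 0 S)) := fun a =>
      (hInt a).aestronglyMeasurable.smul_const (P a)
    rw [hF']
    exact Finset.aestronglyMeasurable_fun_sum Finset.univ fun a _ => hsm a
  · refine (MeasureTheory.ae_restrict_mem measurableSet_Ioc).mono fun s hs y _ => ?_
    refine (clm_norm_le_sum _).trans ?_
    rw [Finset.sum_mul]
    refine Finset.sum_le_sum fun a _ => ?_
    have h1 : 0 < s ^ (p - 1) := Real.rpow_pos_of_pos hs.1 _
    rw [happ, abs_mul, abs_of_pos h1, Real.rpow_add hs.1]
    calc s ^ (p - 1) * |avg (pd a η) f s y| ≤ s ^ (p - 1) * (N * moment α (pd a η) * s ^ α) :=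
          mul_le_mul_of_nonneg_left (abs_avg_le_of_integral_eq_zero hα (hη.pd a)
            (hη.integral_pd a) hf hs.1 y) h1.le
      _ = _ := by ring
  · refine (MeasureTheory.ae_restrict_mem measurableSet_Ioc).mono fun s hs y _ => ?_
    refine ((differentiable_avg hη hfc hs.1 y).hasFDerivAt.const_mul (s ^ p)).congr_fderiv ?_
    rw [clm_eq_sum_proj (s ^ p • fderiv ℝ (avg η f s) y), hF']
    simp only [← hP]
    refine Finset.sum_congr rfl fun a _ => ?_
    congr 1
    rw [_root_.smul_apply, smul_eq_mul]
    change s ^ p * pd a (avg η f s) y = _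
    rw [pd_avg hη hfc hs.1, Real.rpow_sub hs.1, Real.rpow_one]
    ring

lemma differentiable_pot (hα : α ∈ Ioo (0 : ℝ) 1) (hη : IsTest η) (hf : HolderBound α univ 0 N f)
    (hp : 0 ≤ p) : Differentiable ℝ (pot η f p S) := fun x =>
  (hasFDerivAt_pot hα hη hf hp x).differentiableAt

lemma pd_pot (hα : α ∈ Ioo (0 : ℝ) 1) (hη : IsTest η) (hf : HolderBound α univ 0 N f)
    (hp : 0 ≤ p) (a : Fin n) : pd a (pot η f p S) = pot (pd a η) f (p - 1) S := by
  ext x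
  rw [pd, (hasFDerivAt_pot hα hη hf hp x).fderiv]
  simp [Pi.single_apply]

lemma abs_avg_sub_avg_le (hα : α ∈ Ioo (0 : ℝ) 1) (hη : IsTest η) (hf : HolderBound α univ 0 N f)
    {s : ℝ} (hs : 0 < s) (x y : Pt n) :
    |avg η f s x - avg η f s y| ≤ N * (∑ a, moment α (pd a η)) * s ^ (α - 1) * ‖x - y‖ := by
  have hfc : Continuous f := continuousOn_univ.mp (hf.continuousOn hα.1)
  refine convex_univ.norm_image_sub_le_of_norm_fderiv_le (𝕜 := ℝ)
    (fun z _ => differentiable_avg hη hfc hs z) (fun z _ => ?_) (mem_univ y) (mem_univ x)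
  refine (clm_norm_le_sum _).trans ?_
  rw [Finset.mul_sum, Finset.sum_mul]
  refine Finset.sum_le_sum fun a _ => ?_
  change |pd a (avg η f s) z| ≤ _
  rw [pd_avg hη hfc hs, abs_mul, abs_of_pos (inv_pos.mpr hs), Real.rpow_sub hs, Real.rpow_one]
  calc s⁻¹ * |avg (pd a η) f s z| ≤ s⁻¹ * (N * moment α (pd a η) * s ^ α) :=
        mul_le_mul_of_nonneg_left (abs_avg_le_of_integral_eq_zero hα (hη.pd a)
          (hη.integral_pd a) hf hs z) (inv_pos.mpr hs).le
    _ = _ := by ring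

lemma integral_two_scale (hα : α ∈ Ioo (0 : ℝ) 1) {h : ℝ} (hh : 0 < h) :
    MeasureTheory.Integrable (fun s : ℝ => (Ioc 0 h).indicator (fun s => s ^ (α - 1)) s
      + (Ioi h).indicator (fun s => h * s ^ (α - 2)) s) ∧
    ∫ s : ℝ, ((Ioc 0 h).indicator (fun s => s ^ (α - 1)) s
      + (Ioi h).indicator (fun s => h * s ^ (α - 2)) s) = (1 / α + 1 / (1 - α)) * h ^ α := by
  have h1 : MeasureTheory.IntegrableOn (fun s : ℝ => s ^ (α - 1)) (Ioc 0 h) :=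
    integrableOn_rpow_Ioc (by linarith [hα.1]) h
  have h2 : MeasureTheory.IntegrableOn (fun s : ℝ => h * s ^ (α - 2)) (Ioi h) :=
    (integrableOn_Ioi_rpow_of_lt (by linarith [hα.2]) hh).const_mul h
  have i1 := h1.integrable_indicator measurableSet_Ioc
  have i2 := h2.integrable_indicator measurableSet_Ioi
  refine ⟨i1.add i2, ?_⟩
  rw [MeasureTheory.integral_add i1 i2, MeasureTheory.integral_indicator measurableSet_Ioc,
    MeasureTheory.integral_indicator measurableSet_Ioi, MeasureTheory.integral_const_mul,
    integral_Ioi_rpow_of_lt (by linarith [hα.2]) hh, ← intervalIntegral.integral_of_le hh.le,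
    integral_rpow (Or.inl (by linarith [hα.1]))]
  have e1 : α - 1 + 1 = α := by ring
  have e2 : α - 2 + 1 = α - 1 := by ring
  have n1 : α ≠ 0 := hα.1.ne'
  have n2 : α - 1 ≠ 0 := by linarith [hα.2]
  have n3 : 1 - α ≠ 0 := by linarith [hα.2]
  rw [e1, e2, Real.zero_rpow n1, Real.rpow_sub hh, Real.rpow_one]
  field_simp
  ring

lemma abs_pot_sub_pot_le (hα : α ∈ Ioo (0 : ℝ) 1) (hη : IsTest η) (h0 : ∫ z, η z = 0)
    (hf : HolderBound α univ 0 N f) (x y : Pt n) :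
    |pot η f (-1) S x - pot η f (-1) S y| ≤
      ((2 * moment α η + ∑ a, moment α (pd a η)) * (1 / α + 1 / (1 - α))) * N * ‖x - y‖ ^ α := by
  rcases eq_or_ne x y with rfl | hxy
  · simp [Real.zero_rpow hα.1.ne']
  have hh : 0 < ‖x - y‖ := norm_pos_iff.mpr (sub_ne_zero.mpr hxy)
  set h := ‖x - y‖ with hhdef
  have hN := hf.nonneg
  have hm0 := moment_nonneg α η
  have hm1 : 0 ≤ ∑ a, moment α (pd a η) := Finset.sum_nonneg fun a _ => moment_nonneg α _
  set K := 2 * moment α η + ∑ a, moment α (pd a η) with hK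
  have hK0 : 0 ≤ K := by positivity
  obtain ⟨hBi, hB⟩ := integral_two_scale hα hh
  set B : ℝ → ℝ := fun s => (Ioc 0 h).indicator (fun s => s ^ (α - 1)) s
      + (Ioi h).indicator (fun s => h * s ^ (α - 2)) s with hBdef
  have hB0 : ∀ s, 0 ≤ B s := fun s => by
    refine add_nonneg (indicator_nonneg (fun t ht => Real.rpow_nonneg ht.1.le _) s)
      (indicator_nonneg (fun t ht => ?_) s)
    exact mul_nonneg hh.le (Real.rpow_nonneg (hh.le.trans (le_of_lt ht)) _)
  have hp' : -1 < -1 + α := by linarith [hα.1]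
  rw [pot, pot, ← MeasureTheory.integral_sub
    (integrableOn_pot_of_integral_eq_zero hα hη h0 hf hp' x)
    (integrableOn_pot_of_integral_eq_zero hα hη h0 hf hp' y), ← Real.norm_eq_abs]
  calc ‖∫ s in Ioc 0 S, (s ^ (-1 : ℝ) * avg η f s x - s ^ (-1 : ℝ) * avg η f s y)‖
      ≤ ∫ s in Ioc 0 S, (K * N) * B s := by
        refine MeasureTheory.norm_integral_le_of_norm_le (hBi.const_mul _).integrableOn ?_
        refine (MeasureTheory.ae_restrict_mem measurableSet_Ioc).mono fun s hs => ?_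
        have hs0 : 0 < s := hs.1
        rw [← mul_sub, norm_mul, Real.norm_of_nonneg (Real.rpow_nonneg hs0.le _)]
        rcases le_or_gt s h with hsh | hsh
        · have hBs : B s = s ^ (α - 1) := by
            simp [hBdef, hs0, hsh]
          have h1 := abs_avg_le_of_integral_eq_zero hα hη h0 hf hs0 x
          have h2 := abs_avg_le_of_integral_eq_zero hα hη h0 hf hs0 y
          have h3 : |avg η f s x - avg η f s y| ≤ K * N * s ^ α := by
            refine (abs_sub _ _).trans ((add_le_add h1 h2).trans ?_)
            rw [hK]
            have := mul_nonneg (mul_nonneg hm1 hN) (Real.rpow_nonneg hs0.le α)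
            linarith
          have e : s ^ (α - 1) = s ^ (-1 : ℝ) * s ^ α := by
            rw [← Real.rpow_add hs0]; congr 1; ring
          rw [hBs, e]
          calc s ^ (-1 : ℝ) * ‖avg η f s x - avg η f s y‖ ≤ s ^ (-1 : ℝ) * (K * N * s ^ α) :=
                mul_le_mul_of_nonneg_left h3 (Real.rpow_nonneg hs0.le _)
            _ = _ := by ring
        · have hBs : B s = h * s ^ (α - 2) := by
            simp [hBdef, hsh]
          have h3 : |avg η f s x - avg η f s y| ≤ K * N * (s ^ (α - 1) * h) := by
            refine (abs_avg_sub_avg_le hα hη hf hs0 x y).trans ?_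
            rw [hK, ← hhdef]
            have := mul_nonneg (mul_nonneg hm0 hN) (mul_nonneg (Real.rpow_nonneg hs0.le (α - 1)) hh.le)
            linarith
          have e : s ^ (α - 2) = s ^ (-1 : ℝ) * s ^ (α - 1) := by
            rw [← Real.rpow_add hs0]; congr 1; ring
          rw [hBs, e]
          calc s ^ (-1 : ℝ) * ‖avg η f s x - avg η f s y‖
              ≤ s ^ (-1 : ℝ) * (K * N * (s ^ (α - 1) * h)) :=
                mul_le_mul_of_nonneg_left h3 (Real.rpow_nonneg hs0.le _)
            _ = _ := by ring
    _ ≤ ∫ s, (K * N) * B s := MeasureTheory.setIntegral_le_integral (hBi.const_mul _)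
        (Filter.Eventually.of_forall fun s => mul_nonneg (by positivity) (hB0 s))
    _ = _ := by rw [MeasureTheory.integral_const_mul, hB]; ring

/-- Schauder estimate for the truncated potential. -/
lemma exists_holderBound_pot (hα : α ∈ Ioo (0 : ℝ) 1) (hη : IsTest η) (hS : 0 ≤ S) :
    ∃ C, 0 ≤ C ∧ ∀ (m : ℕ) (N : ℝ) (f : Pt n → ℝ), HolderBound α univ m N f →
      HolderBound α univ (m + 2) (C * N) (pot η f 1 S) := by
  have hIoc : 0 ≤ ∫ s in Ioc 0 S, s ^ (-1 + α) :=
    MeasureTheory.setIntegral_nonneg measurableSet_Ioc fun s hs => Real.rpow_nonneg hs.1.le _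
  have hI : ∀ ζ : Pt n → ℝ, 0 ≤ ∫ z, |ζ z| := fun ζ =>
    MeasureTheory.integral_nonneg fun z => abs_nonneg _
  have hq : 0 ≤ 1 / α + 1 / (1 - α) :=
    add_nonneg (one_div_nonneg.mpr hα.1.le) (one_div_nonneg.mpr (by linarith [hα.2]))
  set c0 := S ^ (1 : ℝ) * (∫ z, |η z|) * S with hc0
  set c1 : Fin n → ℝ := fun a => S ^ (0 : ℝ) * (∫ z, |pd a η z|) * S with hc1
  set c2 : Fin n → Fin n → ℝ := fun a b => moment α (pd b (pd a η)) * ∫ s in Ioc 0 S, s ^ (-1 + α)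
    with hc2
  set c3 : Fin n → Fin n → ℝ := fun a b => (2 * moment α (pd b (pd a η)) +
    ∑ c, moment α (pd c (pd b (pd a η)))) * (1 / α + 1 / (1 - α)) with hc3
  have c0n : 0 ≤ c0 := mul_nonneg (mul_nonneg (Real.rpow_nonneg hS _) (hI _)) hS
  have c1n : ∀ a, 0 ≤ c1 a := fun a => mul_nonneg (mul_nonneg (Real.rpow_nonneg hS _) (hI _)) hS
  have c2n : ∀ a b, 0 ≤ c2 a b := fun a b => mul_nonneg (moment_nonneg _ _) hIoc
  have c3n : ∀ a b, 0 ≤ c3 a b := fun a b => mul_nonneg (add_nonneg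
    (mul_nonneg (by norm_num) (moment_nonneg _ _))
    (Finset.sum_nonneg fun c _ => moment_nonneg _ _)) hq
  set C := c0 + ∑ a, (c1 a + ∑ b, (c2 a b + c3 a b)) with hC
  have hin : ∀ a, 0 ≤ ∑ b, (c2 a b + c3 a b) := fun a =>
    Finset.sum_nonneg fun b _ => add_nonneg (c2n a b) (c3n a b)
  have hCa : ∀ a, c0 + (c1 a + ∑ b, (c2 a b + c3 a b)) ≤ C := fun a =>
    add_le_add_right (Finset.single_le_sum (f := fun a => c1 a + ∑ b, (c2 a b + c3 a b))
      (fun a _ => add_nonneg (c1n a) (hin a)) (Finset.mem_univ a)) c0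
  have hCab : ∀ a b, c2 a b + c3 a b ≤ C := fun a b => by
    have := Finset.single_le_sum (f := fun b => c2 a b + c3 a b)
      (fun b _ => add_nonneg (c2n a b) (c3n a b)) (Finset.mem_univ b)
    linarith [hCa a, c1n a]
  have hCn : 0 ≤ C := add_nonneg c0n (Finset.sum_nonneg fun a _ => add_nonneg (c1n a) (hin a))
  have hC0 : c0 ≤ C := le_add_of_nonneg_right
    (Finset.sum_nonneg fun a _ => add_nonneg (c1n a) (hin a))
  refine ⟨C, hCn, fun m => ?_⟩
  induction m with
  | zero =>
    intro N f hf
    have hN := hf.nonneg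
    have hCN : 0 ≤ C * N := mul_nonneg hCn hN
    have hb : ∀ x, |f x| ≤ N := fun x => hf.bound x trivial
    refine ⟨hCN, fun x _ => (abs_pot_le hη hb (by norm_num) hS x).trans
      (mul_le_mul_of_nonneg_right hC0 hN), fun x _ =>
      differentiable_pot hα hη hf (by norm_num) x, fun a => ?_⟩
    rw [pd_pot hα hη hf (by norm_num), sub_self]
    refine ⟨hCN, fun x _ => (abs_pot_le (hη.pd a) hb le_rfl hS x).trans
      (mul_le_mul_of_nonneg_right ?_ hN), fun x _ =>
      differentiable_pot hα (hη.pd a) hf le_rfl x, fun b => ?_⟩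
    · have := hCa a
      have := hin a
      simp only [hc1] at *
      linarith
    rw [pd_pot hα (hη.pd a) hf le_rfl, zero_sub]
    have hz := (hη.pd a).integral_pd b
    refine ⟨hCN, fun x _ => (abs_pot_le_of_integral_eq_zero hα ((hη.pd a).pd b) hz hf
      (by linarith [hα.1]) x).trans (mul_le_mul_of_nonneg_right ?_ hN), fun x _ y _ =>
      (abs_pot_sub_pot_le hα ((hη.pd a).pd b) hz hf x y).trans ?_⟩
    · exact (le_add_of_nonneg_right (c3n a b)).trans (hCab a b)
    · refine mul_le_mul_of_nonneg_right (mul_le_mul_of_nonneg_right ?_ hN)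
        (Real.rpow_nonneg (norm_nonneg _) _)
      exact (le_add_of_nonneg_left (c2n a b)).trans (hCab a b)
  | succ m ih =>
    intro N f hf
    have hN := hf.nonneg
    have hf0 := hf.of_le hα convex_univ (Nat.zero_le _)
    have hfd : Differentiable ℝ f := fun x => hf.2.2.1 x trivial
    have hcomm : ∀ a, pd a (pot η f 1 S) = pot η (pd a f) 1 S := fun a => by
      ext x
      rw [pd_pot hα hη hf0 (by norm_num), sub_self]
      refine MeasureTheory.setIntegral_congr_fun measurableSet_Ioc fun s hs => ?_
      rw [avg_pd_comm hη hfd a (continuousOn_univ.mp ((hf.2.2.2 a).continuousOn hα.1)) hs.1,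
        Real.rpow_zero, Real.rpow_one, one_mul, mul_inv_cancel_left₀ hs.1.ne']
    refine ⟨mul_nonneg hCn hN, fun x _ => (abs_pot_le hη (fun x => hf.bound x trivial)
      (by norm_num) hS x).trans (mul_le_mul_of_nonneg_right hC0 hN), fun x _ =>
      differentiable_pot hα hη hf0 (by norm_num) x, fun a => ?_⟩
    rw [hcomm]
    exact ih N _ (hf.2.2.2 a)

lemma pot_sub {M : ℝ} (hη : IsTest η) (hf : Continuous f) (hfb : ∀ x, |f x| ≤ N)
    (hg : Continuous g) (hgb : ∀ x, |g x| ≤ M) (hp : -1 < p) (x : Pt n) :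
    pot η (fun y => f y - g y) p S x = pot η f p S x - pot η g p S x := by
  rw [pot, pot, pot, ← MeasureTheory.integral_sub (integrableOn_pot_of_bound hη hf hfb hp x)
    (integrableOn_pot_of_bound hη hg hgb hp x)]
  congr 1
  ext s
  rw [← mul_sub, avg, avg, avg, ← MeasureTheory.integral_sub (integrable_avg hη hf s x)
    (integrable_avg hη hg s x)]
  simp only [mul_sub]

lemma dilation_eq_sum (hη : IsTest η) (z : Pt n) :
    dilation η z = ∑ a, pd a (fun y => y a * η y) z := by
  have h : ∀ a, pd a (fun y : Pt n => y a * η y) z = η z + z a * pd a η z := fun a => by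
    rw [pd_mul (by fun_prop) (hη.differentiable z), pd_coord]
    simp
  simp only [h, Finset.sum_add_distrib, Finset.sum_const, Finset.card_univ, Fintype.card_fin,
    nsmul_eq_mul, dilation]
  congr 1
  conv_lhs => rw [clm_eq_sum_proj (fderiv ℝ η z)]
  simp [pd, mul_comm]

lemma integral_dilation (hη : IsTest η) : ∫ z, dilation η z = 0 := by
  have ht : ∀ a : Fin n, IsTest (fun y : Pt n => y a * η y) := fun a =>
    ⟨(contDiff_apply ℝ ℝ a).mul hη.1, hη.2.mul_left⟩
  simp only [dilation_eq_sum hη]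
  rw [MeasureTheory.integral_finsetSum _ fun a _ => ((ht a).pd a).integrable]
  exact Finset.sum_eq_zero fun a _ => (ht a).integral_pd a

lemma pot_dilation (hα : α ∈ Ioo (0 : ℝ) 1) (hη : IsTest η) (hf : HolderBound α univ 0 N f)
    (hS : 0 < S) (x : Pt n) :
    pot (dilation η) f (-1) S x = (∫ z, η z) * f x - avg η f S x := by
  have hfc : Continuous f := continuousOn_univ.mp (hf.continuousOn hα.1)
  have hInt := integrableOn_pot_of_integral_eq_zero (S := S) hα hη.dilation (integral_dilation hη) hf
    (p := -1) (by linarith [hα.1]) x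
  have hlim : Filter.Tendsto (fun s => avg η f s x) (nhdsWithin 0 (Ioi 0))
      (nhds ((∫ z, η z) * f x)) := by
    rw [tendsto_iff_norm_sub_tendsto_zero]
    refine squeeze_zero' (Filter.Eventually.of_forall fun _ => norm_nonneg _)
      (Filter.eventually_of_mem self_mem_nhdsWithin fun s hs =>
        abs_avg_sub_le hα.1 hη hf hs x) ?_
    have h2 : ContinuousAt (fun s : ℝ => N * moment α η * s ^ α) 0 :=
      continuousAt_const.mul (Real.continuousAt_rpow_const 0 α (Or.inr hα.1.le))
    have h3 := h2.tendsto
    simp only [Real.zero_rpow hα.1.ne', mul_zero] at h3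
    exact h3.mono_left nhdsWithin_le_nhds
  have key := intervalIntegral.integral_eq_sub_of_hasDerivAt_of_tendsto hS
    (f := fun s => avg η f s x) (f' := fun s => -(s ^ (-1 : ℝ) * avg (dilation η) f s x))
    (fun s hs => by rw [Real.rpow_neg_one]; exact hasDerivAt_avg hη hfc hs.1 x)
    ((intervalIntegrable_iff_integrableOn_Ioc_of_le hS.le).mpr hInt.neg) hlim
    ((hasDerivAt_avg hη hfc hS x).continuousAt.tendsto.mono_left nhdsWithin_le_nhds)
  rw [intervalIntegral.integral_of_le hS.le, MeasureTheory.integral_neg] at key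
  rw [pot]
  linarith

lemma sum_pot_eq (hα : α ∈ Ioo (0 : ℝ) 1) {ψ φ : Pt n → ℝ} (hψ : IsTest ψ) (hφ : IsTest φ)
    (A : Fin n → Fin n → ℝ) (hA : ∀ z, ∑ i, ∑ j, A i j * pd i (pd j ψ) z = -dilation φ z)
    (hf : HolderBound α univ 0 N f) (hS : 0 < S) (x : Pt n) :
    ∑ i, ∑ j, A i j * pd i (pd j (pot ψ f 1 S)) x = avg φ f S x - (∫ z, φ z) * f x := by
  have hfc : Continuous f := continuousOn_univ.mp (hf.continuousOn hα.1)
  have hpd : ∀ i j, pd i (pd j (pot ψ f 1 S)) = pot (pd i (pd j ψ)) f (-1) S := fun i j => by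
    rw [pd_pot hα hψ hf (by norm_num), sub_self, pd_pot hα (hψ.pd j) hf le_rfl, zero_sub]
  have hInt : ∀ i j, MeasureTheory.IntegrableOn
      (fun s => A i j * (s ^ (-1 : ℝ) * avg (pd i (pd j ψ)) f s x)) (Ioc 0 S) := fun i j =>
    (integrableOn_pot_of_integral_eq_zero hα ((hψ.pd j).pd i) ((hψ.pd j).integral_pd i) hf
      (by linarith [hα.1]) x).const_mul _
  have havg : ∀ s, avg (dilation φ) f s x = -∑ i, ∑ j, A i j * avg (pd i (pd j ψ)) f s x := by
    intro s
    have e : dilation φ = fun z => -∑ i, ∑ j, A i j * pd i (pd j ψ) z := by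
      ext z; rw [hA, neg_neg]
    simp only [e, avg, neg_mul, Finset.sum_mul, MeasureTheory.integral_neg]
    congr 1
    have hi : ∀ i j, MeasureTheory.Integrable
        fun z => A i j * pd i (pd j ψ) z * f (x - s • z) := fun i j => by
      simp only [mul_assoc]
      exact (integrable_avg ((hψ.pd j).pd i) hfc s x).const_mul _
    rw [MeasureTheory.integral_finsetSum _ fun i _ =>
      MeasureTheory.integrable_finsetSum _ fun j _ => hi i j]
    refine Finset.sum_congr rfl fun i _ => ?_
    rw [MeasureTheory.integral_finsetSum _ fun j _ => hi i j]
    refine Finset.sum_congr rfl fun j _ => ?_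
    simp only [mul_assoc]
    rw [MeasureTheory.integral_const_mul]
  have h1 : pot (dilation φ) f (-1) S x = -∑ i, ∑ j, A i j * pot (pd i (pd j ψ)) f (-1) S x := by
    have e : ∀ s, s ^ (-1 : ℝ) * avg (dilation φ) f s x =
        -∑ i, ∑ j, A i j * (s ^ (-1 : ℝ) * avg (pd i (pd j ψ)) f s x) := fun s => by
      rw [havg, mul_neg, Finset.mul_sum]
      simp only [Finset.mul_sum, mul_left_comm (s ^ (-1 : ℝ))]
    rw [pot]
    simp only [e]
    rw [MeasureTheory.integral_neg, MeasureTheory.integral_finsetSum _ fun i _ =>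
      MeasureTheory.integrable_finsetSum _ fun j _ => hInt i j]
    congr 1
    refine Finset.sum_congr rfl fun i _ => ?_
    rw [MeasureTheory.integral_finsetSum _ fun j _ => hInt i j]
    exact Finset.sum_congr rfl fun j _ => MeasureTheory.integral_const_mul _ _
  simp only [hpd]
  linarith [pot_dilation hα hφ hf hS x]

end

/-! ### The kernel adapted to a constant-coefficient operator -/

lemma exists_radial_profile : ∃ θ H : ℝ → ℝ, ContDiff ℝ (⊤ : ℕ∞) θ ∧ ContDiff ℝ (⊤ : ℕ∞) H ∧
    (∀ t, HasDerivAt H (-(θ t) / 2) t) ∧ (∀ t, 3 ≤ t → θ t = 0 ∧ H t = 0) ∧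
    (∀ t, t ≤ 1 → θ t = 0) ∧ (∀ t, 0 ≤ θ t) ∧ θ 2 = 1 := by
  let b : ContDiffBump (2 : ℝ) := ⟨1 / 2, 1, by norm_num, by norm_num⟩
  have hb : ContDiff ℝ (⊤ : ℕ∞) b := b.contDiff
  have hz : ∀ t : ℝ, 1 ≤ |t - 2| → b t = 0 := fun t ht => b.zero_of_le_dist (by
    rw [Real.dist_eq]; exact ht)
  have hd : ∀ t, HasDerivAt (fun t => -(1 / 2) * ∫ u in (3 : ℝ)..t, b u) (-(b t) / 2) t := fun t => by
    have := (hb.continuous.integral_hasStrictDerivAt 3 t).hasDerivAt.const_mul (-(1 / 2))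
    exact this.congr_deriv (by ring)
  refine ⟨b, fun t => -(1 / 2) * ∫ u in (3 : ℝ)..t, b u, hb, ?_, hd, fun t ht => ⟨?_, ?_⟩,
    fun t ht => ?_, fun t => b.nonneg, b.one_of_mem_closedBall (by simp [b])⟩
  · rw [contDiff_infty_iff_deriv]
    refine ⟨fun t => (hd t).differentiableAt, ?_⟩
    rw [show deriv (fun t => -(1 / 2) * ∫ u in (3 : ℝ)..t, b u) = fun t => -(b t) / 2 from
      funext fun t => (hd t).deriv]
    exact hb.neg.div_const 2
  · exact hz t (by rw [abs_of_nonneg] <;> linarith)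
  · beta_reduce
    rw [intervalIntegral.integral_zero_ae, mul_zero]
    refine Filter.Eventually.of_forall fun u hu => hz u ?_
    rw [uIoc_of_le ht] at hu
    rw [abs_of_nonneg] <;> linarith [hu.1]
  · exact hz t (by rw [abs_of_nonpos] <;> linarith)

lemma exists_le_quadratic {n : ℕ} {G : Matrix (Fin n) (Fin n) ℝ} (hG : G.PosDef) :
    ∃ c : ℝ, 0 < c ∧ ∀ y : Pt n, c * ‖y‖ ^ 2 ≤ y ⬝ᵥ G *ᵥ y := by
  have hcont : Continuous fun y : Pt n => y ⬝ᵥ G *ᵥ y := by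
    simp only [dotProduct, mulVec]
    fun_prop
  have hpos : ∀ y : Pt n, y ≠ 0 → 0 < y ⬝ᵥ G *ᵥ y := fun y hy => by
    simpa using hG.dotProduct_mulVec_pos hy
  rcases (Metric.sphere (0 : Pt n) 1).eq_empty_or_nonempty with he | hne
  · refine ⟨1, one_pos, fun y => ?_⟩
    have hy : y = 0 := by
      by_contra hy
      have : ‖y‖⁻¹ • y ∈ Metric.sphere (0 : Pt n) 1 := by
        rw [mem_sphere_zero_iff_norm, norm_smul, norm_inv, norm_norm,
          inv_mul_cancel₀ (norm_ne_zero_iff.mpr hy)]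
      simp [he] at this
    simp [hy]
  · obtain ⟨v, hv, hmin⟩ := (isCompact_sphere (0 : Pt n) 1).exists_isMinOn hne hcont.continuousOn
    have hv0 : v ≠ 0 := by
      rintro rfl
      simp at hv
    refine ⟨v ⬝ᵥ G *ᵥ v, hpos v hv0, fun y => ?_⟩
    rcases eq_or_ne y 0 with rfl | hy
    · simp
    have hy' : ‖y‖ ≠ 0 := norm_ne_zero_iff.mpr hy
    have hm : ‖y‖⁻¹ • y ∈ Metric.sphere (0 : Pt n) 1 := by
      rw [mem_sphere_zero_iff_norm, norm_smul, norm_inv, norm_norm, inv_mul_cancel₀ hy']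
    have : v ⬝ᵥ G *ᵥ v ≤ (‖y‖⁻¹ • y) ⬝ᵥ G *ᵥ (‖y‖⁻¹ • y) := hmin hm
    simp only [mulVec_smul, smul_dotProduct, dotProduct_smul, smul_eq_mul] at this
    have h2 := mul_le_mul_of_nonneg_right this (sq_nonneg ‖y‖)
    refine h2.trans (le_of_eq ?_)
    field_simp

/-- A smooth compactly supported solution `ψ` of `G⁻¹ : ∇²ψ = -div (φ z)`. -/
lemma exists_kernel {n : ℕ} (hn : 0 < n) {G : Matrix (Fin n) (Fin n) ℝ} (hs : G.IsSymm)
    (hG : G.PosDef) : ∃ ψ φ : Pt n → ℝ, IsTest ψ ∧ IsTest φ ∧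
      (∀ z, ∑ i, ∑ j, G⁻¹ i j * pd i (pd j ψ) z = -dilation φ z) ∧ 0 < ∫ z, φ z ∧
      ∃ δ > 0, ∀ z, φ z ≠ 0 → δ ≤ ‖z‖ := by
  obtain ⟨θ, H, hθ, hH, hd, h3, h1, hθ0, hθ2⟩ := exists_radial_profile
  obtain ⟨c, hc, hcQ⟩ := exists_le_quadratic hG
  obtain ⟨Q, hQ⟩ : ∃ Q : Pt n → ℝ, Q = fun y => ∑ i, y i * ∑ j, G i j * y j := ⟨_, rfl⟩
  have hQc : ∀ y, c * ‖y‖ ^ 2 ≤ Q y := fun y => by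
    simpa [hQ, dotProduct, mulVec] using hcQ y
  have hQs : ContDiff ℝ (⊤ : ℕ∞) Q := by
    rw [hQ]
    fun_prop
  have hQd : Differentiable ℝ Q := hQs.differentiable (by simp)
  have hlin : ∀ i (y : Pt n), DifferentiableAt ℝ (fun y : Pt n => ∑ j, G i j * y j) y :=
    fun i y => by fun_prop
  have hpdlin : ∀ i a (y : Pt n), pd a (fun y : Pt n => ∑ j, G i j * y j) y = G i a := by
    intro i a y
    rw [pd_sum _ fun j _ => by fun_prop]
    have : ∀ j, pd a (fun y : Pt n => G i j * y j) y = if j = a then G i j else 0 := fun j => by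
      rw [pd_const_mul (by fun_prop), pd_coord]
      simp
    simp [this]
  have hpdQ : ∀ a y, pd a Q y = 2 * ∑ j, G a j * y j := by
    intro a y
    rw [hQ, pd_sum _ fun i _ => by fun_prop]
    have : ∀ i, pd a (fun y : Pt n => y i * ∑ j, G i j * y j) y =
        (if i = a then ∑ j, G i j * y j else 0) + G a i * y i := fun i => by
      rw [pd_mul (by fun_prop) (hlin i y), pd_coord, hpdlin, hs.apply a i]
      simp [mul_comm]
    simp only [this, Finset.sum_add_distrib, Finset.sum_ite_eq', Finset.mem_univ, if_true]
    ring
  have hcomp : ∀ (F : ℝ → ℝ), (∀ t, 3 ≤ t → F t = 0) → HasCompactSupport fun y => F (Q y) := by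
    intro F hF
    refine HasCompactSupport.intro (isCompact_closedBall (0 : Pt n) (Real.sqrt (3 / c))) fun y hy => ?_
    refine hF _ (le_trans ?_ (hQc y))
    rw [mem_closedBall_zero_iff, not_le] at hy
    have := Real.lt_sq_of_sqrt_lt hy
    rw [div_lt_iff₀ hc] at this
    linarith
  have hψ : IsTest fun y => H (Q y) := ⟨hH.comp hQs, hcomp H fun t ht => (h3 t ht).2⟩
  have hφ : IsTest fun y => θ (Q y) := ⟨hθ.comp hQs, hcomp θ fun t ht => (h3 t ht).1⟩
  have hpdψ : ∀ j, pd j (fun y => H (Q y)) = fun y => -(θ (Q y) * ∑ l, G j l * y l) := by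
    intro j
    ext y
    have : HasFDerivAt (fun y => H (Q y)) ((-(θ (Q y)) / 2) • fderiv ℝ Q y) y :=
      (hd (Q y)).comp_hasFDerivAt y (hQd y).hasFDerivAt
    rw [pd, this.fderiv, _root_.smul_apply, smul_eq_mul]
    change _ * pd j Q y = _
    rw [hpdQ]
    ring
  have hdet : IsUnit G.det := hG.det_pos.ne'.isUnit
  refine ⟨_, _, hψ, hφ, fun z => ?_, ?_, ?_⟩
  · have hpp : ∀ i j, pd i (pd j fun y => H (Q y)) z =
        -(pd i (fun y => θ (Q y)) z * ∑ l, G j l * z l + θ (Q z) * G j i) := by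
      intro i j
      rw [hpdψ]
      have : ∀ f : Pt n → ℝ, pd i (fun y => -f y) z = -pd i f z := fun f => by simp [pd]
      rw [this, pd_mul (hφ.differentiable z) (hlin j z), hpdlin]
    simp only [hpp]
    have e1 : ∀ i l, ∑ j, G⁻¹ i j * G j l = if i = l then 1 else 0 := fun i l => by
      have := congrFun (congrFun (nonsing_inv_mul G hdet) i) l
      rw [mul_apply, one_apply] at this
      exact this
    have e2 : ∀ i, ∑ j, G⁻¹ i j * -(pd i (fun y => θ (Q y)) z * ∑ l, G j l * z l + θ (Q z) * G j i)
        = -(pd i (fun y => θ (Q y)) z * z i + θ (Q z)) := by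
      intro i
      have a1 : ∑ j, G⁻¹ i j * ∑ l, G j l * z l = z i := by
        simp only [Finset.mul_sum, ← mul_assoc]
        rw [Finset.sum_comm]
        simp only [← Finset.sum_mul, e1]
        simp
      have a2 := e1 i i
      rw [if_pos rfl] at a2
      calc _ = -(pd i (fun y => θ (Q y)) z * ∑ j, G⁻¹ i j * ∑ l, G j l * z l
            + θ (Q z) * ∑ j, G⁻¹ i j * G j i) := by
            rw [Finset.mul_sum, Finset.mul_sum, ← Finset.sum_add_distrib, ← Finset.sum_neg_distrib]
            exact Finset.sum_congr rfl fun j _ => by ring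
        _ = _ := by rw [a1, a2, mul_one]
    simp only [e2, Finset.sum_neg_distrib, Finset.sum_add_distrib, Finset.sum_const,
      Finset.card_univ, Fintype.card_fin, nsmul_eq_mul, dilation]
    conv_rhs => rw [clm_eq_sum_proj (fderiv ℝ (fun y => θ (Q y)) z)]
    simp [pd, add_comm]
  · have hv : ∃ y, Q y = 2 := by
      let v : Pt n := Pi.single ⟨0, hn⟩ 1
      have hv0 : 0 < Q v := lt_of_lt_of_le (by
        have : v ≠ 0 := by simp [v]
        have := norm_pos_iff.mpr this
        positivity) (hQc v)
      refine ⟨Real.sqrt (2 / Q v) • v, ?_⟩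
      have hsm : ∀ (t : ℝ) y, Q (t • y) = t ^ 2 * Q y := fun t y => by
        simp only [hQ, Pi.smul_apply, smul_eq_mul, Finset.mul_sum]
        exact Finset.sum_congr rfl fun i _ => Finset.sum_congr rfl fun j _ => by ring
      rw [hsm, Real.sq_sqrt (by positivity)]
      field_simp
    obtain ⟨y, hy⟩ := hv
    refine hφ.1.continuous.integral_pos_of_hasCompactSupport_nonneg_nonzero hφ.2
      (fun z => hθ0 _) (x := y) ?_
    simp [hy, hθ2]
  · have : ContinuousAt Q 0 := hQs.continuous.continuousAt
    have h0 : Q 0 < 1 := by simp [hQ]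
    obtain ⟨δ, hδ, hball⟩ := Metric.mem_nhds_iff.mp (this.eventually_lt_const h0)
    refine ⟨δ, hδ, fun z hz => ?_⟩
    contrapose! hz
    exact h1 _ (le_of_lt (hball (by simpa using hz)))

/-! ### A right inverse of the constant-coefficient operator -/

section

variable {n : ℕ} {α N M : ℝ} {m : ℕ}

lemma avg_eq_zero {φ f : Pt n → ℝ} {δ S : ℝ} (hδ : ∀ z, φ z ≠ 0 → δ ≤ ‖z‖) (hS : 0 ≤ S)
    (hδS : 4 ≤ S * δ) (hf : ∀ x ∉ Metric.closedBall (0 : Pt n) 2, f x = 0) {x : Pt n}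
    (hx : x ∈ Metric.ball (0 : Pt n) 2) : avg φ f S x = 0 := by
  refine MeasureTheory.integral_eq_zero_of_ae (Filter.Eventually.of_forall fun z => ?_)
  change φ z * f (x - S • z) = 0
  by_cases hz : φ z = 0
  · rw [hz, zero_mul]
  rw [hf _ fun h => ?_, mul_zero]
  rw [mem_closedBall_zero_iff] at h
  rw [mem_ball_zero_iff] at hx
  have h1 : ‖S • z‖ ≤ ‖x‖ + ‖x - S • z‖ := by
    have := norm_sub_le x (x - S • z)
    rwa [sub_sub_cancel] at this
  rw [norm_smul, Real.norm_of_nonneg hS] at h1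
  have := mul_le_mul_of_nonneg_left (hδ z hz) hS
  linarith

lemma HolderBound.sub_affine {P : Pt n → ℝ}
    (hP : HolderBound α univ (m + 1) N P) :
    HolderBound α (Metric.ball 0 3) (m + 1) (N + N + n * (N * 3))
      (fun x => P x - P 0 - ∑ a, _root_.pd a P 0 * x a) := by
  have ho : IsOpen (Metric.ball (0 : Pt n) 3) := Metric.isOpen_ball
  have h1 := hP.mono_set (subset_univ (Metric.ball (0 : Pt n) 3))
  have h2 : HolderBound α (Metric.ball (0 : Pt n) 3) (m + 1) N (fun _ => P 0) :=
    (HolderBound.const _).mono_const (hP.bound 0 trivial)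
  have h3 := HolderBound.sum (α := α) (m := m + 1) ho Finset.univ (B := fun _ => N * 3)
    (F := fun a x => _root_.pd a P 0 * x a) fun a _ =>
      ((HolderBound.coord (by norm_num) a).const_mul ho _).mono_const
        (mul_le_mul_of_nonneg_right ((hP.pd a).bound 0 trivial) (by norm_num))
  simpa using (h1.sub ho h2).sub ho h3

lemma pd_sub_affine {P : Pt n → ℝ} (hP : Differentiable ℝ P) (c : ℝ) (σ : Fin n → ℝ) (j : Fin n) :
    pd j (fun x => P x - c - ∑ a, σ a * x a) = fun x => pd j P x - σ j := by
  ext x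
  rw [pd_sub ((hP x).sub_const c) (by fun_prop), pd_sub (hP x) (by fun_prop), pd_const,
    pd_sum _ fun a _ => by fun_prop]
  have : ∀ a, pd j (fun y : Pt n => σ a * y a) x = if a = j then σ a else 0 := fun a => by
    rw [pd_const_mul (by fun_prop), pd_coord]
    simp
  simp [this]

/-- A bounded right inverse of `w ↦ ∑ G⁻¹ i j ∂ᵢ∂ⱼ w` on functions supported in a fixed ball, with
vanishing first-order jet at the origin. -/
lemma exists_right_inverse (hα : α ∈ Ioo (0 : ℝ) 1) (hn : 0 < n) {G : Matrix (Fin n) (Fin n) ℝ}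
    (hs : G.IsSymm) (hG : G.PosDef) (m : ℕ) :
    ∃ (T : (Pt n → ℝ) → Pt n → ℝ) (C : ℝ), 0 ≤ C ∧
      (∀ N w, HolderBound α univ m N w →
        HolderBound α (Metric.ball 0 3) (m + 2) (C * N) (T w) ∧ T w 0 = 0 ∧
        (∀ a, pd a (T w) 0 = 0) ∧ ((∀ x ∉ Metric.closedBall (0 : Pt n) 2, w x = 0) →
          ∀ x ∈ Metric.ball (0 : Pt n) 2, ∑ i, ∑ j, G⁻¹ i j * pd i (pd j (T w)) x = w x)) ∧
      ∀ N M v w, HolderBound α univ m N v → HolderBound α univ m M w →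
        T (fun x => v x - w x) = fun x => T v x - T w x := by
  obtain ⟨ψ, φ, hψ, hφ, hA, hc, δ, hδ, hsupp⟩ := exists_kernel hn hs hG
  set c := ∫ z, φ z with hcdef
  obtain ⟨S, hS⟩ : ∃ S, S = 4 / δ := ⟨_, rfl⟩
  have hS0 : 0 < S := by rw [hS]; positivity
  have hSδ : 4 ≤ S * δ := by rw [hS, div_mul_cancel₀ _ hδ.ne']
  obtain ⟨C, hC, hpot⟩ := exists_holderBound_pot hα hψ hS0.le
  set P : (Pt n → ℝ) → Pt n → ℝ := fun w x => -c⁻¹ * pot ψ w 1 S x with hPdef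
  have hP : ∀ N w, HolderBound α univ m N w → HolderBound α univ (m + 1 + 1) (|-c⁻¹| * (C * N)) (P w) :=
    fun N w hw => (hpot m N w hw).const_mul isOpen_univ _
  have hPd : ∀ N w, HolderBound α univ m N w → Differentiable ℝ (P w) :=
    fun N w hw x => (hP N w hw).differentiableAt x trivial
  have hcont : ∀ N (w : Pt n → ℝ), HolderBound α univ m N w → Continuous w := fun N w hw =>
    continuousOn_univ.mp (hw.continuousOn hα.1)
  have hPsub : ∀ N M v w, HolderBound α univ m N v → HolderBound α univ m M w →
      P (fun x => v x - w x) = fun x => P v x - P w x := fun N M v w hv hw => by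
    ext x
    simp only [hPdef]
    rw [pot_sub hψ (hcont N v hv) (fun x => hv.bound x trivial) (hcont M w hw)
      (fun x => hw.bound x trivial) (by norm_num)]
    ring
  refine ⟨fun w x => P w x - P w 0 - ∑ a, pd a (P w) 0 * x a,
    |-c⁻¹| * C * (2 + 3 * n), by positivity, fun N w hw => ⟨?_, ?_, fun a => ?_, fun h0 x hx => ?_⟩,
    fun N M v w hv hw => ?_⟩
  · refine ((hP N w hw).sub_affine).mono_const (le_of_eq ?_)
    ring
  · simp
  · rw [pd_sub_affine (hPd N w hw)]
    simp
  · have h2 : ∀ i j, pd i (pd j (fun x => P w x - P w 0 - ∑ a, pd a (P w) 0 * x a)) x =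
        -c⁻¹ * pd i (pd j (pot ψ w 1 S)) x := by
      intro i j
      have hp1 := hpot m N w hw
      have e : pd j (P w) = fun x => -c⁻¹ * pd j (pot ψ w 1 S) x := by
        ext y
        exact pd_const_mul (hp1.differentiableAt y trivial) _ _
      rw [pd_sub_affine (hPd N w hw), pd_sub (((hP N w hw).pd j).differentiableAt x trivial)
        (by fun_prop), pd_const, e, pd_const_mul ((hp1.pd j).differentiableAt x trivial), sub_zero]
    have h3 := sum_pot_eq hα hψ hφ (fun i j => G⁻¹ i j) hA
      (hw.of_le hα convex_univ (Nat.zero_le m)) hS0 x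
    rw [avg_eq_zero hsupp hS0.le hSδ h0 hx, zero_sub] at h3
    simp only [h2, mul_left_comm _ (-c⁻¹), ← Finset.mul_sum]
    rw [h3, ← hcdef]
    field_simp
  · have e : ∀ a, pd a (P fun x => v x - w x) 0 = pd a (P v) 0 - pd a (P w) 0 := fun a => by
      rw [hPsub N M v w hv hw]
      exact pd_sub (hPd N v hv 0) (hPd M w hw 0) a
    ext x
    simp only [e]
    rw [hPsub N M v w hv hw]
    simp only [sub_mul, Finset.sum_sub_distrib]
    ring

/-! ### Contractions on Hölder functions -/

lemma exists_fixed_point {A : (Pt n → ℝ) → Pt n → ℝ}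
    (hA : ∀ N f, HolderBound α univ m N f → HolderBound α univ m (N / 2) (A f))
    (hsub : ∀ N M f g, HolderBound α univ m N f → HolderBound α univ m M g →
      A (fun x => f x - g x) = fun x => A f x - A g x)
    {F : Pt n → ℝ} (hF : HolderBound α univ m N F) :
    ∃ N' w, HolderBound α univ m N' w ∧ ∀ x, w x = A w x + F x := by
  have hFi : ∀ i : ℕ, HolderBound α univ m (N * (1 / 2) ^ i) (A^[i] F) := by
    intro i
    induction i with
    | zero => simpa using hF
    | succ i ih =>
      rw [Function.iterate_succ_apply']
      refine (hA _ _ ih).mono_const (le_of_eq ?_)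
      ring
  have hsum : Summable fun i : ℕ => N * (1 / 2 : ℝ) ^ i := summable_geometric_two.mul_left N
  have hw := HolderBound.tsum hsum hFi
  obtain ⟨w, hwdef⟩ : ∃ w : Pt n → ℝ, w = fun x => ∑' i, (A^[i] F) x := ⟨_, rfl⟩
  rw [← hwdef] at hw
  have hs : ∀ k : ℕ, HolderBound α univ m (∑ i ∈ Finset.range k, N * (1 / 2) ^ i)
      (fun x => ∑ i ∈ Finset.range k, (A^[i] F) x) := fun k =>
    HolderBound.sum isOpen_univ _ fun i _ => hFi i
  have hAs : ∀ k : ℕ, ∀ x, A (fun x => ∑ i ∈ Finset.range k, (A^[i] F) x) x =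
      ∑ i ∈ Finset.range k, (A^[i + 1] F) x := by
    intro k
    induction k with
    | zero =>
      intro x
      have := congrFun (hsub _ _ F F hF hF) x
      simpa using this
    | succ k ih =>
      intro x
      have := congrFun (hsub _ _ _ _ (hs (k + 1)) (hFi k)) x
      simp only [Finset.sum_range_succ, add_sub_cancel_right] at this
      rw [ih] at this
      rw [Finset.sum_range_succ, Function.iterate_succ_apply']
      simp only [Finset.sum_range_succ]
      linarith
  have htail : ∀ k : ℕ, HolderBound α univ m (2 * N * (1 / 2) ^ k)
      (fun x => w x - ∑ i ∈ Finset.range k, (A^[i] F) x) := by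
    intro k
    have hsk : Summable fun i : ℕ => N * (1 / 2 : ℝ) ^ (i + k) := (summable_nat_add_iff k).mpr hsum
    have h1 := HolderBound.tsum hsk fun i => hFi (i + k)
    have e : ∑' i : ℕ, N * (1 / 2 : ℝ) ^ (i + k) = 2 * N * (1 / 2) ^ k := by
      simp only [pow_add, ← mul_assoc]
      rw [tsum_mul_right, tsum_mul_left, tsum_geometric_two]
      ring
    rw [e] at h1
    refine h1.congr isOpen_univ fun x _ => ?_
    have hsx : Summable fun i => (A^[i] F) x :=
      Summable.of_norm_bounded hsum fun i => (hFi i).bound x trivial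
    rw [hwdef]
    have := hsx.sum_add_tsum_nat_add k
    beta_reduce
    linarith
  refine ⟨_, w, hw, fun x => ?_⟩
  have hk : ∀ k : ℕ, |w x - A w x - F x| ≤ 3 * N * (1 / 2) ^ k := by
    intro k
    have h1 := (htail (k + 1)).bound x trivial
    have h2 := (hA _ _ (htail k)).bound x trivial
    rw [hsub _ _ _ _ hw (hs k)] at h2
    beta_reduce at h2
    rw [hAs] at h2
    rw [Finset.sum_range_succ'] at h1
    simp only [Function.iterate_zero, id] at h1
    have hN := mul_nonneg hF.nonneg (pow_nonneg (by norm_num : (0 : ℝ) ≤ 1 / 2) k)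
    rw [pow_succ] at h1
    rw [abs_le] at *
    constructor <;> linarith [h1.1, h1.2, h2.1, h2.2]
  have hlim : Filter.Tendsto (fun k : ℕ => 3 * N * (1 / 2 : ℝ) ^ k) Filter.atTop (nhds 0) := by
    simpa using (tendsto_pow_atTop_nhds_zero_of_lt_one (r := (1 / 2 : ℝ)) (by norm_num)
      (by norm_num)).const_mul (3 * N)
  have := abs_nonpos_iff.mp (ge_of_tendsto' hlim hk)
  linarith

end

/-! ### Local solvability of second-order elliptic equations -/

/-- The second-order differential operator with coefficients `a`, `b`, `c`. -/
def diffOp {n : ℕ} (a : Fin n → Fin n → Pt n → ℝ) (b : Fin n → Pt n → ℝ) (c u : Pt n → ℝ)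
    (x : Pt n) : ℝ :=
  ∑ i, ∑ j, a i j x * pd i (pd j u) x + ∑ i, b i x * pd i u x + c x * u x

section

variable {n : ℕ} {α N M : ℝ} {m : ℕ} {a : Fin n → Fin n → Pt n → ℝ} {b : Fin n → Pt n → ℝ}
  {c u v : Pt n → ℝ} {s : Set (Pt n)}

lemma diffOp_add (hs : IsOpen s) (hu : HolderBound α s (m + 2) N u)
    (hv : HolderBound α s (m + 2) M v) {x : Pt n} (hx : x ∈ s) :
    diffOp a b c (fun y => u y + v y) x = diffOp a b c u x + diffOp a b c v x := by
  have h1 : ∀ j, EqOn (pd j fun y => u y + v y) (fun y => pd j u y + pd j v y) s := fun j y hy =>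
    pd_add (hu.differentiableAt y hy) (hv.differentiableAt y hy) j
  have h2 : ∀ i j, pd i (pd j fun y => u y + v y) x = pd i (pd j u) x + pd i (pd j v) x :=
    fun i j => by
      rw [pd_congr hs (h1 j) i hx]
      exact pd_add ((hu.pd j).differentiableAt x hx) ((hv.pd j).differentiableAt x hx) i
  simp only [diffOp, h2, h1 _ hx, mul_add, Finset.sum_add_distrib]
  ring

lemma diffOp_const_mul (hs : IsOpen s) (hu : HolderBound α s (m + 2) N u) (t : ℝ) {x : Pt n}
    (hx : x ∈ s) : diffOp a b c (fun y => t * u y) x = t * diffOp a b c u x := by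
  have h1 : ∀ j, EqOn (pd j fun y => t * u y) (fun y => t * pd j u y) s := fun j y hy =>
    pd_const_mul (hu.differentiableAt y hy) t j
  have h2 : ∀ i j, pd i (pd j fun y => t * u y) x = t * pd i (pd j u) x :=
    fun i j => by
      rw [pd_congr hs (h1 j) i hx]
      exact pd_const_mul ((hu.pd j).differentiableAt x hx) t i
  simp only [diffOp, h2, h1 _ hx, mul_add, Finset.mul_sum, mul_left_comm t]

lemma diffOp_sub (hs : IsOpen s) (hu : HolderBound α s (m + 2) N u)
    (hv : HolderBound α s (m + 2) M v) {x : Pt n} (hx : x ∈ s) :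
    diffOp a b c (fun y => u y - v y) x = diffOp a b c u x - diffOp a b c v x := by
  have h := diffOp_add (a := a) (b := b) (c := c) hs hu (hv.const_mul hs (-1)) hx
  rw [diffOp_const_mul hs hv (-1) hx] at h
  simpa [sub_eq_add_neg] using h

lemma exists_diffOp_bound (hα : α ∈ Ioo (0 : ℝ) 1) (n m : ℕ) :
    ∃ K : ℝ, 0 ≤ K ∧ ∀ (s : Set (Pt n)), IsOpen s → Convex ℝ s →
      ∀ (κ N : ℝ) (a : Fin n → Fin n → Pt n → ℝ) (b : Fin n → Pt n → ℝ) (c u : Pt n → ℝ),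
        (∀ i j, HolderBound α s m κ (a i j)) → (∀ i, HolderBound α s m κ (b i)) →
        HolderBound α s m κ c → HolderBound α s (m + 2) N u →
        HolderBound α s m (K * (κ * N)) (diffOp a b c u) := by
  obtain ⟨C, hC, hmul⟩ := HolderBound.exists_mul hα n m
  refine ⟨C * (n * n + n * (n + 2) + (n + 2) * (n + 2)), by positivity,
    fun s ho hs κ N a b c u ha hb hc hu => ?_⟩
  have h1 : ∀ i j, HolderBound α s m (C * (κ * N)) (fun x => a i j x * pd i (pd j u) x) :=
    fun i j => hmul s ho hs _ _ _ _ (ha i j) ((hu.pd j).pd i)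
  have h2 : ∀ i, HolderBound α s m (C * (κ * ((n + 2) * N))) (fun x => b i x * pd i u x) :=
    fun i => hmul s ho hs _ _ _ _ (hb i) ((hu.pd i).of_succ hα hs)
  have h3 := hmul s ho hs _ _ _ _ hc ((hu.of_succ hα hs).of_succ hα hs)
  have h4 := ((HolderBound.sum ho Finset.univ fun i _ =>
    HolderBound.sum ho Finset.univ fun j _ => h1 i j).add ho
      (HolderBound.sum ho Finset.univ fun i _ => h2 i)).add ho h3
  refine HolderBound.mono_const h4 (le_of_eq ?_)
  simp only [Finset.sum_const, Finset.card_univ, Fintype.card_fin, nsmul_eq_mul]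
  ring

lemma HolderBound.exists_affine (m : ℕ) (R : ℝ) (hR : 1 ≤ R) (t : ℝ) (σ : Fin n → ℝ) :
    ∃ N, HolderBound α (Metric.ball 0 R) (m + 1) N (fun x => t + ∑ i, σ i * x i) := by
  have ho : IsOpen (Metric.ball (0 : Pt n) R) := Metric.isOpen_ball
  exact ⟨_, (HolderBound.const t).add ho (HolderBound.sum ho Finset.univ fun i _ =>
    (HolderBound.coord hR i).const_mul ho (σ i))⟩

lemma pd_affine (t : ℝ) (σ : Fin n → ℝ) (j : Fin n) :
    pd j (fun x : Pt n => t + ∑ i, σ i * x i) = fun _ => σ j := by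
  ext x
  rw [pd_add (by fun_prop) (by fun_prop), pd_const, pd_sum _ fun a _ => by fun_prop]
  have : ∀ a, pd j (fun y : Pt n => σ a * y a) x = if a = j then σ a else 0 := fun a => by
    rw [pd_const_mul (by fun_prop), pd_coord]
    simp
  simp [this]

/-- Solvability with prescribed first-order jet for operators close to a constant-coefficient one. -/
lemma exists_solution_of_small (hα : α ∈ Ioo (0 : ℝ) 1) (hn : 0 < n)
    {G : Matrix (Fin n) (Fin n) ℝ} (hs : G.IsSymm) (hG : G.PosDef) (m : ℕ) :
    ∃ κ > 0, ∀ (a : Fin n → Fin n → Pt n → ℝ) (b : Fin n → Pt n → ℝ) (c : Pt n → ℝ),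
      (∀ i j, HolderBound α (Metric.ball 0 3) m κ (fun x => a i j x - G⁻¹ i j)) →
      (∀ i, HolderBound α (Metric.ball 0 3) m κ (b i)) →
      HolderBound α (Metric.ball 0 3) m κ c → ∀ (t : ℝ) (σ : Fin n → ℝ),
        ∃ N u, HolderBound α (Metric.ball 0 1) (m + 2) N u ∧
          (∀ x ∈ Metric.ball (0 : Pt n) 1, diffOp a b c u x = 0) ∧ u 0 = t ∧
          ∀ j, pd j u 0 = σ j := by
  obtain ⟨T, C, hC, hT, hTsub⟩ := exists_right_inverse hα hn hs hG m
  obtain ⟨K, hK, hdiff⟩ := exists_diffOp_bound hα n m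
  obtain ⟨Cm, hCm, hmul⟩ := HolderBound.exists_mul hα n m
  let χ : ContDiffBump (0 : Pt n) := ⟨1, 2, by norm_num, by norm_num⟩
  obtain ⟨X, hX⟩ := HolderBound.exists_of_hasCompactSupport hα χ.contDiff χ.hasCompactSupport m
  have hX0 := hX.nonneg
  have ho : IsOpen (Metric.ball (0 : Pt n) 3) := Metric.isOpen_ball
  have hcv : Convex ℝ (Metric.ball (0 : Pt n) 3) := convex_ball 0 3
  have hχ1 : ∀ x ∈ Metric.ball (0 : Pt n) 1, χ x = 1 := fun x hx =>
    χ.one_of_mem_closedBall (Metric.ball_subset_closedBall hx)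
  have hχ0 : ∀ x ∉ Metric.closedBall (0 : Pt n) 2, χ x = 0 := fun x hx =>
    χ.zero_of_le_dist (le_of_lt (not_le.mp hx))
  obtain ⟨D, hD⟩ : ∃ D, D = Cm * (X * (K * C)) := ⟨_, rfl⟩
  have hD0 : 0 ≤ D := by rw [hD]; positivity
  refine ⟨1 / (2 * (D + 1)), by positivity, fun a b c ha hb hc t σ => ?_⟩
  obtain ⟨κ, hκ⟩ : ∃ κ, κ = 1 / (2 * (D + 1)) := ⟨_, rfl⟩
  rw [← hκ] at ha hb hc
  have hκ0 : 0 ≤ κ := hc.nonneg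
  have hDκ : D * κ ≤ 1 / 2 := by
    rw [hκ, mul_one_div, div_le_div_iff₀ (by positivity) (by norm_num)]
    linarith
  obtain ⟨L, hL⟩ : ∃ L, L = diffOp (fun i j x => a i j x - G⁻¹ i j) b c := ⟨_, rfl⟩
  have hLb : ∀ N u, HolderBound α (Metric.ball 0 3) (m + 2) N u →
      HolderBound α univ m (Cm * (X * (K * (κ * N)))) (fun x => χ x * -L u x) := by
    intro N u hu
    refine HolderBound.extend hα (hmul _ ho hcv _ _ _ _ (hX.mono_set (subset_univ _)) ?_)
      fun x hx => ?_
    · rw [hL]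
      exact (hdiff _ ho hcv κ N _ b c u ha hb hc hu).neg ho
    · rw [hχ0 x hx, zero_mul]
  obtain ⟨Nℓ, hℓ⟩ := HolderBound.exists_affine (α := α) (m + 1) 3 (by norm_num) t σ
  set ℓ : Pt n → ℝ := fun x => t + ∑ i, σ i * x i with hℓdef
  obtain ⟨N', w, hw, hfix⟩ := exists_fixed_point (α := α) (m := m)
    (A := fun w x => χ x * -L (T w) x)
    (fun N f hf => by
      refine (hLb _ _ (hT N f hf).1).mono_const ?_
      have := mul_le_mul_of_nonneg_right hDκ hf.nonneg
      rw [hD] at this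
      calc _ = Cm * (X * (K * C)) * κ * N := by ring
        _ ≤ _ := this
        _ = _ := by ring)
    (fun N M f g hf hg => by
      ext x
      by_cases hx : x ∈ Metric.ball (0 : Pt n) 3
      · rw [hTsub N M f g hf hg, hL, diffOp_sub ho (hT N f hf).1 (hT M g hg).1 hx]
        ring
      · rw [hχ0 x fun h => hx (Metric.closedBall_subset_ball (by norm_num) h)]
        ring)
    (hLb _ _ hℓ)
  obtain ⟨hTw, hT0, hTd, hTeq⟩ := hT N' w hw
  have hball : Metric.ball (0 : Pt n) 1 ⊆ Metric.ball 0 3 := Metric.ball_subset_ball (by norm_num)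
  have h03 : (0 : Pt n) ∈ Metric.ball (0 : Pt n) 3 := Metric.mem_ball_self (by norm_num)
  refine ⟨_, fun x => ℓ x + T w x, (hℓ.add ho hTw).mono_set hball, fun x hx => ?_, ?_, fun j => ?_⟩
  · have hx3 := hball hx
    have hwx := hTeq (fun y hy => by rw [hfix, hχ0 y hy]; ring) x
      (Metric.ball_subset_ball (by norm_num) hx)
    have hfx := hfix x
    rw [hχ1 x hx] at hfx
    have hsplit : ∀ u, diffOp a b c u x = ∑ i, ∑ j, G⁻¹ i j * pd i (pd j u) x + L u x := by
      intro u
      rw [hL]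
      simp only [diffOp, sub_mul, Finset.sum_sub_distrib]
      ring
    have hℓ2 : ∀ i j, pd i (pd j ℓ) x = 0 := fun i j => by
      rw [hℓdef, pd_affine, pd_const]
    rw [diffOp_add ho hℓ hTw hx3, hsplit, hsplit, hwx]
    simp only [hℓ2, mul_zero, Finset.sum_const_zero]
    linarith
  · simp [hℓdef, hT0]
  · rw [pd_add (hℓ.differentiableAt 0 h03) (hTw.differentiableAt 0 h03), hTd, hℓdef, pd_affine]
    simp

/-- Local solvability with prescribed first-order jet at the origin. -/
lemma exists_local_solution (hα : α ∈ Ioo (0 : ℝ) 1) (hn : 0 < n)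
    {G : Matrix (Fin n) (Fin n) ℝ} (hs : G.IsSymm) (hG : G.PosDef) {R : ℝ} (hR : 0 < R)
    (ha : ∀ i j, HolderBound α (Metric.ball 0 R) m N (a i j)) (ha0 : ∀ i j, a i j 0 = G⁻¹ i j)
    (hb : ∀ i, HolderBound α (Metric.ball 0 R) m N (b i))
    (hc : HolderBound α (Metric.ball 0 R) m N c) (t : ℝ) (σ : Fin n → ℝ) :
    ∃ ρ > 0, ρ ≤ R ∧ ∃ M u, HolderBound α (Metric.ball 0 ρ) (m + 2) M u ∧
      (∀ x ∈ Metric.ball (0 : Pt n) ρ, diffOp a b c u x = 0) ∧ u 0 = t ∧ ∀ j, pd j u 0 = σ j := by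
  obtain ⟨κ, hκ, hsol⟩ := exists_solution_of_small hα hn hs hG m
  have ho : IsOpen (Metric.ball (0 : Pt n) R) := Metric.isOpen_ball
  have hsm : ∀ i j, ∃ K : ℝ, 0 ≤ K ∧ ∀ ρ, 0 < ρ → ρ ≤ 1 → ρ * 3 ≤ R →
      HolderBound α (Metric.ball 0 3) m (K * ρ ^ α) (fun x => a i j (ρ • x) - G⁻¹ i j) := fun i j =>
    HolderBound.exists_comp_smul_small hα hR (by norm_num)
      ((ha i j).sub ho (HolderBound.const (G⁻¹ i j))) (by simp [ha0])
  choose K hK0 hK using hsm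
  obtain ⟨B, hB⟩ : ∃ B, B = ∑ i, ∑ j, K i j := ⟨_, rfl⟩
  have hKB : ∀ i j, K i j ≤ B := fun i j => by
    rw [hB]
    exact (Finset.single_le_sum (f := fun j => K i j) (fun j _ => hK0 i j) (Finset.mem_univ j)).trans
      (Finset.single_le_sum (f := fun i => ∑ j, K i j)
        (fun i _ => Finset.sum_nonneg fun j _ => hK0 i j) (Finset.mem_univ i))
  have hex : ∃ ρ : ℝ, 0 < ρ ∧ ρ ≤ 1 ∧ ρ * 3 ≤ R ∧ B * ρ ^ α ≤ κ ∧ ρ * N ≤ κ := by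
    have e1 : ∀ᶠ ρ : ℝ in nhdsWithin 0 (Ioi 0), B * ρ ^ α < κ := by
      have h : ContinuousAt (fun ρ : ℝ => B * ρ ^ α) 0 :=
        continuousAt_const.mul (Real.continuousAt_rpow_const 0 α (Or.inr hα.1.le))
      exact (h.eventually_lt_const (by simpa [Real.zero_rpow hα.1.ne'] using hκ)).filter_mono
        nhdsWithin_le_nhds
    have e2 : ∀ᶠ ρ : ℝ in nhdsWithin 0 (Ioi 0), ρ * N < κ :=
      ((continuous_id.mul continuous_const).continuousAt.eventually_lt_const
        (by simpa using hκ)).filter_mono nhdsWithin_le_nhds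
    have e3 : ∀ᶠ ρ : ℝ in nhdsWithin 0 (Ioi 0), ρ * 3 < R :=
      ((continuous_id.mul continuous_const).continuousAt.eventually_lt_const
        (by simpa using hR)).filter_mono nhdsWithin_le_nhds
    have e4 : ∀ᶠ ρ : ℝ in nhdsWithin 0 (Ioi 0), ρ < 1 :=
      (eventually_lt_nhds one_pos).filter_mono nhdsWithin_le_nhds
    obtain ⟨ρ, h1, h2, h3, h4, h5⟩ :=
      (e1.and (e2.and (e3.and (e4.and self_mem_nhdsWithin)))).exists
    exact ⟨ρ, h5, h4.le, h3.le, h1.le, h2.le⟩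
  obtain ⟨ρ, hρ, hρ1, hρR, hBρ, hNρ⟩ := hex
  have hsub : Metric.ball (0 : Pt n) (ρ * 3) ⊆ Metric.ball 0 R := Metric.ball_subset_ball hρR
  have ho3 : IsOpen (Metric.ball (0 : Pt n) 3) := Metric.isOpen_ball
  have hscale : ∀ f, HolderBound α (Metric.ball 0 R) m N f →
      HolderBound α (Metric.ball 0 3) m N (fun x => f (ρ • x)) := fun f hf => by
    simpa using (hf.mono_set hsub).comp_smul hα hρ le_rfl hρ1
  obtain ⟨M, v, hv, hveq, hv0, hvd⟩ := hsol (fun i j x => a i j (ρ • x))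
    (fun i x => ρ * b i (ρ • x)) (fun x => ρ ^ 2 * c (ρ • x))
    (fun i j => (hK i j ρ hρ hρ1 hρR).mono_const
      ((mul_le_mul_of_nonneg_right (hKB i j) (Real.rpow_nonneg hρ.le _)).trans hBρ))
    (fun i => ((hscale _ (hb i)).const_mul ho3 ρ).mono_const (by rwa [abs_of_pos hρ]))
    (((hscale _ hc).const_mul ho3 (ρ ^ 2)).mono_const (by
      rw [abs_of_pos (by positivity)]
      have := hc.nonneg
      nlinarith [mul_nonneg (mul_nonneg hρ.le this) (sub_nonneg.mpr hρ1)]))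
    t (fun i => ρ * σ i)
  have hρi : 0 < ρ⁻¹ := inv_pos.mpr hρ
  have hρn : ρ ≠ 0 := hρ.ne'
  have hmem : ∀ x ∈ Metric.ball (0 : Pt n) ρ, ρ⁻¹ • x ∈ Metric.ball (0 : Pt n) 1 := fun x hx => by
    rw [mem_ball_zero_iff] at hx ⊢
    rw [norm_smul, Real.norm_of_nonneg hρi.le, inv_mul_lt_iff₀ hρ, mul_one]
    exact hx
  have hu := HolderBound.comp_smul (α := α) (R := ρ) (ρ := ρ⁻¹) (K := ρ⁻¹) (f := v) (m := m + 2)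
    (N := M) hα hρi ((one_le_inv₀ hρ).mpr hρ1) le_rfl (by rwa [inv_mul_cancel₀ hρn])
  have hoρ : IsOpen (Metric.ball (0 : Pt n) ρ) := Metric.isOpen_ball
  have hd1 : ∀ j, EqOn (pd j fun x => v (ρ⁻¹ • x)) (fun x => ρ⁻¹ * pd j v (ρ⁻¹ • x))
      (Metric.ball 0 ρ) := fun j x hx => pd_comp_smul (hv.differentiableAt _ (hmem x hx)) j
  have hd2 : ∀ i j, ∀ x ∈ Metric.ball (0 : Pt n) ρ, pd i (pd j fun x => v (ρ⁻¹ • x)) x =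
      ρ⁻¹ * (ρ⁻¹ * pd i (pd j v) (ρ⁻¹ • x)) := fun i j x hx => by
    have hdj := (hv.pd j).differentiableAt _ (hmem x hx)
    rw [pd_congr hoρ (hd1 j) i hx, pd_const_mul _ _ _, pd_comp_smul hdj]
    exact DifferentiableAt.comp x hdj (by fun_prop)
  refine ⟨ρ, hρ, by linarith, _, fun x => v (ρ⁻¹ • x), hu, fun x hx => ?_, by simp [hv0],
    fun j => ?_⟩
  · have h := hveq _ (hmem x hx)
    have hxx : ρ • ρ⁻¹ • x = x := by rw [smul_smul, mul_inv_cancel₀ hρn, one_smul]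
    simp only [diffOp, hxx] at h
    simp only [diffOp, hd2 _ _ x hx, hd1 _ hx]
    calc _ = ρ⁻¹ ^ 2 * (∑ i, ∑ j, a i j x * pd i (pd j v) (ρ⁻¹ • x)
          + ∑ i, ρ * b i x * pd i v (ρ⁻¹ • x) + ρ ^ 2 * c x * v (ρ⁻¹ • x)) := by
          rw [mul_add, mul_add, Finset.mul_sum, Finset.mul_sum]
          simp only [Finset.mul_sum]
          congr 1
          · congr 1
            · exact Finset.sum_congr rfl fun i _ => Finset.sum_congr rfl fun j _ => by ring
            · exact Finset.sum_congr rfl fun i _ => by field_simp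
          · field_simp
      _ = 0 := by rw [h, mul_zero]
  · rw [hd1 j (Metric.mem_ball_self hρ)]
    simp only [smul_zero, hvd]
    field_simp

end

lemma norm_iteratedFDeriv_succ_sub {n : ℕ} (f : Pt n → ℝ) (m : ℕ) (x y : Pt n) :
    ‖iteratedFDeriv ℝ (m + 1) f x - iteratedFDeriv ℝ (m + 1) f y‖ =
      ‖iteratedFDeriv ℝ m (fderiv ℝ f) x - iteratedFDeriv ℝ m (fderiv ℝ f) y‖ := by
  rw [← dist_eq_norm, ← dist_eq_norm, iteratedFDeriv_succ_eq_comp_right,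
    iteratedFDeriv_succ_eq_comp_right]
  exact LinearIsometryEquiv.dist_map _ _ _

/-! ### Germs of Hölder functions at the origin -/

/-- `f` is of class `C^{m+α}` on a neighbourhood of the origin. -/
def LocHolder {n : ℕ} (α : ℝ) (m : ℕ) (f : Pt n → ℝ) : Prop :=
  ∃ N, ∃ r > 0, HolderBound α (Metric.ball 0 r) m N f

namespace LocHolder

open Topology

variable {n : ℕ} {α : ℝ} {m : ℕ} {f g : Pt n → ℝ}

lemma exists_ball_of_eventually {p : Pt n → Prop} (h : ∀ᶠ x in 𝓝 (0 : Pt n), p x) :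
    ∃ r > 0, ∀ x ∈ Metric.ball (0 : Pt n) r, p x :=
  Metric.eventually_nhds_iff_ball.1 h

lemma congr (hf : LocHolder α m f) (h : f =ᶠ[𝓝 0] g) : LocHolder α m g := by
  obtain ⟨N, r, hr, hf⟩ := hf
  obtain ⟨r', hr', h⟩ := exists_ball_of_eventually h
  refine ⟨N, min r r', lt_min hr hr', (hf.mono_set
    (Metric.ball_subset_ball (min_le_left _ _))).congr Metric.isOpen_ball fun x hx => ?_⟩
  exact h x (Metric.ball_subset_ball (min_le_right _ _) hx)

lemma eventually_differentiableAt (hf : LocHolder α (m + 1) f) :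
    ∀ᶠ x in 𝓝 0, DifferentiableAt ℝ f x := by
  obtain ⟨N, r, hr, hf⟩ := hf
  exact Filter.eventually_of_mem (Metric.ball_mem_nhds _ hr) hf.differentiableAt

lemma continuousAt (hα : 0 < α) (hf : LocHolder α m f) : ContinuousAt f 0 := by
  obtain ⟨N, r, hr, hf⟩ := hf
  exact (hf.continuousOn hα).continuousAt (Metric.ball_mem_nhds _ hr)

lemma pd (hf : LocHolder α (m + 1) f) (a : Fin n) : LocHolder α m (pd a f) := by
  obtain ⟨N, r, hr, hf⟩ := hf
  exact ⟨N, r, hr, hf.pd a⟩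

lemma of_le (hα : α ∈ Ioo (0 : ℝ) 1) {m' : ℕ} (hm : m' ≤ m) (hf : LocHolder α m f) :
    LocHolder α m' f := by
  obtain ⟨N, r, hr, hf⟩ := hf
  exact ⟨_, r, hr, hf.of_le hα (convex_ball _ _) hm⟩

/-- Finitely many germs are represented on a common ball with a common bound. -/
lemma exists_common {ι : Type*} (t : Finset ι) {F : ι → Pt n → ℝ}
    (h : ∀ i ∈ t, LocHolder α m (F i)) :
    ∃ N, ∃ r > 0, ∀ i ∈ t, HolderBound α (Metric.ball 0 r) m N (F i) := by
  classical
  induction t using Finset.induction_on with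
  | empty => exact ⟨0, 1, one_pos, by simp⟩
  | insert i t hi ih =>
    obtain ⟨N, r, hr, h1⟩ := ih fun j hj => h j (by simp [hj])
    obtain ⟨N', r', hr', h2⟩ := h i (by simp)
    refine ⟨max N N', min r r', lt_min hr hr', fun j hj => ?_⟩
    rcases Finset.mem_insert.1 hj with rfl | hj
    · exact (h2.mono_set (Metric.ball_subset_ball (min_le_right _ _))).mono_const
        (le_max_right _ _)
    · exact ((h1 j hj).mono_set (Metric.ball_subset_ball (min_le_left _ _))).mono_const
        (le_max_left _ _)

lemma of_pd (hd : ∀ᶠ x in 𝓝 0, DifferentiableAt ℝ f x)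
    (h : ∀ a, LocHolder α m (_root_.pd a f)) : LocHolder α (m + 1) f := by
  obtain ⟨N, r, hr, h⟩ := exists_common Finset.univ fun a _ => h a
  have hb : ∀ᶠ x in 𝓝 (0 : Pt n), |f x| ≤ |f 0| + 1 := by
    have := hd.self_of_nhds.continuousAt.abs
    filter_upwards [this.eventually_lt continuousAt_const (lt_add_one |f 0|)] with x hx
    exact hx.le
  obtain ⟨r', hr', h'⟩ := exists_ball_of_eventually (hd.and hb)
  refine ⟨max N (|f 0| + 1), min r r', lt_min hr hr', le_max_of_le_right (by positivity),
    fun x hx => ?_, fun x hx => ?_, fun a => ?_⟩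
  · exact ((h' x (Metric.ball_subset_ball (min_le_right _ _) hx)).2).trans (le_max_right _ _)
  · exact (h' x (Metric.ball_subset_ball (min_le_right _ _) hx)).1
  · exact ((h a (Finset.mem_univ a)).mono_set
      (Metric.ball_subset_ball (min_le_left _ _))).mono_const (le_max_left _ _)

lemma const (c : ℝ) : LocHolder α m (fun _ : Pt n => c) :=
  ⟨_, 1, one_pos, HolderBound.const c⟩

lemma const_mul (hf : LocHolder α m f) (c : ℝ) : LocHolder α m (fun x => c * f x) := by
  obtain ⟨N, r, hr, hf⟩ := hf
  exact ⟨_, r, hr, hf.const_mul Metric.isOpen_ball c⟩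

lemma add (hf : LocHolder α m f) (hg : LocHolder α m g) :
    LocHolder α m (fun x => f x + g x) := by
  obtain ⟨N, r, hr, h⟩ := exists_common Finset.univ (F := fun b : Bool => if b then f else g)
    (by rintro (_ | _) _ <;> simpa)
  exact ⟨_, r, hr, (h true (by simp)).add Metric.isOpen_ball (h false (by simp))⟩

lemma sub (hf : LocHolder α m f) (hg : LocHolder α m g) :
    LocHolder α m (fun x => f x - g x) := by
  simpa [sub_eq_add_neg] using hf.add (hg.const_mul (-1))

lemma mul (hα : α ∈ Ioo (0 : ℝ) 1) (hf : LocHolder α m f) (hg : LocHolder α m g) :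
    LocHolder α m (fun x => f x * g x) := by
  obtain ⟨N, r, hr, h⟩ := exists_common Finset.univ (F := fun b : Bool => if b then f else g)
    (by rintro (_ | _) _ <;> simpa)
  obtain ⟨C, -, hC⟩ := HolderBound.exists_mul hα n m
  exact ⟨_, r, hr, hC _ Metric.isOpen_ball (convex_ball _ _) _ _ _ _ (h true (by simp))
    (h false (by simp))⟩

lemma sum {ι : Type*} (t : Finset ι) {F : ι → Pt n → ℝ} (h : ∀ i ∈ t, LocHolder α m (F i)) :
    LocHolder α m (fun x => ∑ i ∈ t, F i x) := by
  obtain ⟨N, r, hr, h⟩ := exists_common t h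
  exact ⟨_, r, hr, HolderBound.sum Metric.isOpen_ball t h⟩

lemma prod (hα : α ∈ Ioo (0 : ℝ) 1) {ι : Type*} (t : Finset ι) {F : ι → Pt n → ℝ}
    (h : ∀ i ∈ t, LocHolder α m (F i)) : LocHolder α m (fun x => ∏ i ∈ t, F i x) := by
  classical
  induction t using Finset.induction_on with
  | empty => simpa using const 1
  | insert i t hi ih =>
    simp only [Finset.prod_insert hi]
    exact (h i (by simp)).mul hα (ih fun j hj => h j (by simp [hj]))

lemma rpow (hα : α ∈ Ioo (0 : ℝ) 1) (hf : LocHolder α m f) (h0 : 0 < f 0) (p : ℝ) :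
    LocHolder α m (fun x => f x ^ p) := by
  induction m generalizing p with
  | zero =>
    obtain ⟨K, t, ht, hK⟩ := (Real.contDiffAt_rpow_const_of_ne (p := p) (n := 1)
      h0.ne').exists_lipschitzOnWith
    obtain ⟨r', hr', h'⟩ := exists_ball_of_eventually (hf.continuousAt hα.1 ht)
    obtain ⟨N, r, hr, hf⟩ := hf
    have h'' : ∀ x ∈ Metric.ball (0 : Pt n) (min r r'), f x ∈ t := fun x hx =>
      h' x (Metric.ball_subset_ball (min_le_right _ _) hx)
    replace hf := hf.mono_set (Metric.ball_subset_ball (min_le_left r r'))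
    have hN := hf.nonneg
    have h0m : (0 : Pt n) ∈ Metric.ball (0 : Pt n) (min r r') :=
      Metric.mem_ball_self (lt_min hr hr')
    refine ⟨|f 0 ^ p| + K * (2 * N), min r r', lt_min hr hr', by positivity, fun x hx => ?_,
      fun x hx y hy => ?_⟩
    · have h1 := hK.dist_le_mul _ (h'' x hx) _ (h'' 0 h0m)
      simp only [Real.dist_eq] at h1
      have h2 : |f x - f 0| ≤ 2 * N :=
        (abs_sub _ _).trans (by linarith [hf.bound x hx, hf.bound 0 h0m])
      have h3 := mul_le_mul_of_nonneg_left h2 K.coe_nonneg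
      have h4 := abs_sub_abs_le_abs_sub (f x ^ p) (f 0 ^ p)
      linarith
    · have h1 := hK.dist_le_mul _ (h'' x hx) _ (h'' y hy)
      simp only [Real.dist_eq] at h1
      have h2 := mul_le_mul_of_nonneg_left (hf.2.2 x hx y hy) K.coe_nonneg
      have h3 : (0 : ℝ) ≤ ‖x - y‖ ^ α := by positivity
      have h4 : 0 ≤ |f 0 ^ p| * ‖x - y‖ ^ α := by positivity
      have h5 : 0 ≤ K * N * ‖x - y‖ ^ α := by positivity
      linarith
  | succ m ih =>
    have hpos : ∀ᶠ x in 𝓝 (0 : Pt n), 0 < f x :=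
      (hf.continuousAt hα.1).eventually_const_lt h0
    refine of_pd ?_ fun a => ?_
    · filter_upwards [hf.eventually_differentiableAt, hpos] with x hx hx0
      exact hx.rpow_const (Or.inl hx0.ne')
    · refine (((ih (hf.of_le hα (Nat.le_succ m)) (p - 1)).mul hα (hf.pd a)).const_mul p).congr ?_
      filter_upwards [hf.eventually_differentiableAt, hpos] with x hx hx0
      have := (hx.hasFDerivAt.rpow_const (p := p) (Or.inl hx0.ne')).fderiv
      simp only [_root_.pd, this, _root_.smul_apply, smul_eq_mul]
      ring

lemma of_contDiffOn (hα : α ∈ Ioo (0 : ℝ) 1) {s : Set (Pt n)} (hs : IsOpen s)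
    (h0 : (0 : Pt n) ∈ s) (hf : ContDiffOn ℝ m f s) {C : ℝ} (hC : 0 ≤ C)
    (h : ∀ x ∈ s, ∀ y ∈ s,
      ‖iteratedFDeriv ℝ m f x - iteratedFDeriv ℝ m f y‖ ≤ C * ‖x - y‖ ^ α) :
    LocHolder α m f := by
  induction m generalizing f C with
  | zero =>
    have h' : ∀ x ∈ s, ∀ y ∈ s, |f x - f y| ≤ C * ‖x - y‖ ^ α := fun x hx y hy => by
      have := h x hx y hy
      rwa [iteratedFDeriv_zero_eq_comp, Function.comp_apply, Function.comp_apply, ← map_sub,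
        LinearIsometryEquiv.norm_map] at this
    obtain ⟨r, hr, hrs⟩ := Metric.isOpen_iff.1 hs 0 h0
    have hrs' : ∀ x ∈ Metric.ball (0 : Pt n) (min r 1), x ∈ s := fun x hx =>
      hrs (Metric.ball_subset_ball (min_le_left _ _) hx)
    refine ⟨|f 0| + C, min r 1, lt_min hr one_pos, by positivity, fun x hx => ?_,
      fun x hx y hy => (h' x (hrs' x hx) y (hrs' y hy)).trans ?_⟩
    · have h1 := h' x (hrs' x hx) 0 h0
      have h2 : ‖x - 0‖ ^ α ≤ 1 := by
        rw [sub_zero]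
        refine Real.rpow_le_one (norm_nonneg _) ?_ hα.1.le
        rw [mem_ball_zero_iff] at hx
        exact (hx.trans_le (min_le_right _ _)).le
      have h3 := mul_le_mul_of_nonneg_left h2 hC
      have h4 := abs_sub_abs_le_abs_sub (f x) (f 0)
      linarith
    · have : (0 : ℝ) ≤ |f 0| := abs_nonneg _
      gcongr
      linarith
  | succ m ih =>
    have hf' := (contDiffOn_succ_iff_fderiv_of_isOpen (n := (m : WithTop ℕ∞)) hs).1
      (by exact_mod_cast hf)
    refine of_pd ?_ fun a => ?_
    · filter_upwards [hs.mem_nhds h0] with x hx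
      exact hf'.1.differentiableAt (hs.mem_nhds hx)
    · set L : (Pt n →L[ℝ] ℝ) →L[ℝ] ℝ := ContinuousLinearMap.apply ℝ ℝ (Pi.single a 1) with hL
      have e : _root_.pd a f = L ∘ fderiv ℝ f := rfl
      have e2 : ∀ x ∈ s, iteratedFDeriv ℝ m (_root_.pd a f) x =
          L.compContinuousMultilinearMap (iteratedFDeriv ℝ m (fderiv ℝ f) x) := fun x hx => by
        rw [e, L.iteratedFDeriv_comp_left (hf'.2.2.contDiffAt (hs.mem_nhds hx)) le_rfl]
      refine ih (C := ‖L‖ * C) (e ▸ L.contDiff.comp_contDiffOn hf'.2.2) (by positivity)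
        fun x hx y hy => ?_
      have h1 := h x hx y hy
      rw [norm_iteratedFDeriv_succ_sub] at h1
      have e3 : iteratedFDeriv ℝ m (_root_.pd a f) x - iteratedFDeriv ℝ m (_root_.pd a f) y =
          L.compContinuousMultilinearMap (iteratedFDeriv ℝ m (fderiv ℝ f) x -
            iteratedFDeriv ℝ m (fderiv ℝ f) y) := by
        rw [e2 x hx, e2 y hy]
        ext v
        simp
      rw [e3, mul_assoc]
      exact (L.norm_compContinuousMultilinearMap_le _).trans
        (mul_le_mul_of_nonneg_left h1 (norm_nonneg _))

lemma of_cHolderOn (hα : α ∈ Ioo (0 : ℝ) 1) {s : Set (Pt n)} (hs : IsOpen s)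
    (h0 : (0 : Pt n) ∈ s) (hf : CHolderOn m α s f) : LocHolder α m f := by
  obtain ⟨C, t, ht, hC⟩ := hf.2 0 h0
  rw [hs.nhdsWithin_eq h0] at ht
  obtain ⟨r, hr, hrt⟩ := Metric.mem_nhds_iff.1 (Filter.inter_mem ht (hs.mem_nhds h0))
  refine of_contDiffOn hα Metric.isOpen_ball (Metric.mem_ball_self hr)
    (hf.1.mono fun x hx => (hrt hx).2) C.coe_nonneg fun x hx y hy => ?_
  have := hC.dist_le (hrt hx).1 (hrt hy).1
  rwa [iteratedFDerivWithin_of_isOpen m hs (hrt hx).2,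
    iteratedFDerivWithin_of_isOpen m hs (hrt hy).2, dist_eq_norm, dist_eq_norm,
    Real.coe_toNNReal _ hα.1.le] at this

end LocHolder

lemma HolderBound.exists_iteratedFDeriv {n : ℕ} {α : ℝ} (hα : 0 < α) {s : Set (Pt n)}
    (hs : IsOpen s) {m : ℕ} {N : ℝ} {f : Pt n → ℝ} (hf : HolderBound α s m N f) :
    ContDiffOn ℝ m f s ∧ ∃ C : ℝ, 0 ≤ C ∧ ∀ x ∈ s, ∀ y ∈ s,
      ‖iteratedFDeriv ℝ m f x - iteratedFDeriv ℝ m f y‖ ≤ C * ‖x - y‖ ^ α := by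
  induction m generalizing f with
  | zero =>
    refine ⟨contDiffOn_zero.2 (hf.continuousOn hα), N, hf.nonneg, fun x hx y hy => ?_⟩
    rw [iteratedFDeriv_zero_eq_comp, Function.comp_apply, Function.comp_apply, ← map_sub,
        LinearIsometryEquiv.norm_map]
    exact hf.2.2 x hx y hy
  | succ m ih =>
    choose hcd C hC hCb using fun a => ih (hf.pd a)
    set L : Fin n → ℝ →L[ℝ] (Pt n →L[ℝ] ℝ) := fun a =>
      (ContinuousLinearMap.id ℝ ℝ).smulRight
        (ContinuousLinearMap.proj (R := ℝ) (φ := fun _ : Fin n => ℝ) a) with hL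
    have e : fderiv ℝ f = fun x => ∑ a, (L a ∘ _root_.pd a f) x := by
      funext x
      exact clm_eq_sum_proj (fderiv ℝ f x)
    have hLc : ∀ a, ContDiffOn ℝ m (L a ∘ _root_.pd a f) s := fun a =>
      (L a).contDiff.comp_contDiffOn (hcd a)
    refine ⟨?_, ∑ a, ‖L a‖ * C a, Finset.sum_nonneg fun a _ => mul_nonneg (norm_nonneg (L a)) (hC a),
      fun x hx y hy => ?_⟩
    · have := (contDiffOn_succ_iff_fderiv_of_isOpen (𝕜 := ℝ) (f := f) (n := (m : WithTop ℕ∞)) hs).2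
        ⟨fun x hx => (hf.differentiableAt x hx).differentiableWithinAt, by simp, by
          rw [e]; exact ContDiffOn.sum fun a _ => hLc a⟩
      exact_mod_cast this
    · have e2 : ∀ z ∈ s, iteratedFDeriv ℝ m (fderiv ℝ f) z =
          ∑ a, (L a).compContinuousMultilinearMap (iteratedFDeriv ℝ m (_root_.pd a f) z) := by
        intro z hz
        rw [e, iteratedFDeriv_fun_sum_apply fun a _ => (hLc a).contDiffAt (hs.mem_nhds hz)]
        exact Finset.sum_congr rfl fun a _ => (L a).iteratedFDeriv_comp_left
          ((hcd a).contDiffAt (hs.mem_nhds hz)) le_rfl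
      rw [norm_iteratedFDeriv_succ_sub, e2 x hx, e2 y hy, ← Finset.sum_sub_distrib, Finset.sum_mul]
      refine (norm_sum_le _ _).trans (Finset.sum_le_sum fun a _ => ?_)
      have e3 : (L a).compContinuousMultilinearMap (iteratedFDeriv ℝ m (_root_.pd a f) x) -
          (L a).compContinuousMultilinearMap (iteratedFDeriv ℝ m (_root_.pd a f) y) =
          (L a).compContinuousMultilinearMap (iteratedFDeriv ℝ m (_root_.pd a f) x -
            iteratedFDeriv ℝ m (_root_.pd a f) y) := by
        ext v
        simp
      rw [e3, mul_assoc]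
      exact ((L a).norm_compContinuousMultilinearMap_le _).trans
        (mul_le_mul_of_nonneg_left (hCb a x hx y hy) (norm_nonneg _))

lemma HolderBound.cHolderOn {n : ℕ} {α : ℝ} (hα : 0 < α) {s : Set (Pt n)}
    (hs : IsOpen s) {m : ℕ} {N : ℝ} {f : Pt n → ℝ} (hf : HolderBound α s m N f) :
    CHolderOn m α s f := by
  obtain ⟨h1, C, hC, h2⟩ := hf.exists_iteratedFDeriv hα hs
  lift C to NNReal using hC
  refine ⟨h1, fun _ _ => ⟨C, s, self_mem_nhdsWithin, fun x hx y hy => ?_⟩⟩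
  rw [iteratedFDerivWithin_of_isOpen m hs hx, iteratedFDerivWithin_of_isOpen m hs hy,
    edist_nndist, edist_nndist, ← ENNReal.coe_rpow_of_nonneg _ NNReal.zero_le_coe,
    ← ENNReal.coe_mul, ENNReal.coe_le_coe, ← NNReal.coe_le_coe]
  simpa [Real.coe_toNNReal _ hα.le, dist_eq_norm] using h2 x hx y hy

/-! ### Regularity of the geometric quantities -/

namespace LocHolder

open Topology

variable {n : ℕ} {α : ℝ} {m : ℕ}

lemma det (hα : α ∈ Ioo (0 : ℝ) 1) {A : Pt n → Matrix (Fin n) (Fin n) ℝ}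
    (hA : ∀ i j, LocHolder α m fun x => A x i j) : LocHolder α m fun x => (A x).det := by
  simp only [Matrix.det_apply']
  exact sum _ fun τ _ => (prod hα _ fun i _ => hA _ _).const_mul _

lemma inv_apply (hα : α ∈ Ioo (0 : ℝ) 1) {A : Pt n → Matrix (Fin n) (Fin n) ℝ}
    (hA : ∀ i j, LocHolder α m fun x => A x i j) (h0 : 0 < (A 0).det) (i j : Fin n) :
    LocHolder α m fun x => (A x)⁻¹ i j := by
  have hadj : LocHolder α m fun x => (A x).adjugate i j := by
    simp only [Matrix.adjugate_apply]
    refine det hα fun k l => ?_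
    by_cases hk : k = j
    · subst hk
      simpa using const _
    · simpa [Matrix.updateRow_ne hk] using hA k l
  have := ((det hα hA).rpow hα h0 (-1)).mul hα hadj
  simpa only [Matrix.inv_def, Matrix.smul_apply, smul_eq_mul, Ring.inverse_eq_inv',
    Real.rpow_neg_one] using this

lemma sqrt_det (hα : α ∈ Ioo (0 : ℝ) 1) {A : Pt n → Matrix (Fin n) (Fin n) ℝ}
    (hA : ∀ i j, LocHolder α m fun x => A x i j) (h0 : 0 < (A 0).det) :
    LocHolder α m fun x => Real.sqrt (A x).det := by
  simpa only [Real.sqrt_eq_rpow] using (det hα hA).rpow hα h0 (1 / 2)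

variable {g : Met n}

lemma christoffel (hα : α ∈ Ioo (0 : ℝ) 1) (hg : ∀ a b, LocHolder α (m + 1) fun x => g x a b)
    (h0 : 0 < (g 0).det) (c a b : Fin n) : LocHolder α m (christoffel g c a b) := by
  have hi := inv_apply hα (fun a b => (hg a b).of_le hα (Nat.le_succ m)) h0
  exact (sum _ fun d _ => (hi c d).mul hα
    ((((hg b d).pd a).add ((hg a d).pd b)).sub ((hg a b).pd d))).const_mul _

lemma ricci (hα : α ∈ Ioo (0 : ℝ) 1) (hg : ∀ a b, LocHolder α (m + 2) fun x => g x a b)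
    (h0 : 0 < (g 0).det) (a b : Fin n) : LocHolder α m (ricci g a b) := by
  have h1 := christoffel (m := m + 1) hα hg h0
  have h2 := fun c a b => (h1 c a b).of_le hα (Nat.le_succ m)
  exact (((sum _ fun c _ => (h1 c a b).pd c).sub (sum _ fun c _ => (h1 c c b).pd a)).add
    (sum _ fun c _ => sum _ fun d _ => (h2 c a b).mul hα (h2 d d c))).sub
    (sum _ fun c _ => sum _ fun d _ => (h2 d c b).mul hα (h2 c a d))

lemma scalarCurv (hα : α ∈ Ioo (0 : ℝ) 1) (hg : ∀ a b, LocHolder α (m + 2) fun x => g x a b)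
    (h0 : 0 < (g 0).det) : LocHolder α m (scalarCurv g) :=
  sum _ fun a _ => sum _ fun b _ => (inv_apply hα
    (fun a b => (hg a b).of_le hα (Nat.le_add_right m 2)) h0 a b).mul hα (ricci hα hg h0 a b)

end LocHolder

/-! ### The conformal Laplacian in non-divergence form -/

/-- First order coefficients of the Laplace–Beltrami operator in non-divergence form. -/
def laplaceDrift {n : ℕ} (g : Met n) (b : Fin n) (x : Pt n) : ℝ :=
  (Real.sqrt (g x).det)⁻¹ * ∑ a, pd a (fun y => Real.sqrt (g y).det * (g y)⁻¹ a b) x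

lemma LocHolder.laplaceDrift {n : ℕ} {α : ℝ} (hα : α ∈ Ioo (0 : ℝ) 1) {m : ℕ} {g : Met n}
    (hg : ∀ a b, LocHolder α (m + 1) fun x => g x a b) (h0 : 0 < (g 0).det) (b : Fin n) :
    LocHolder α m (laplaceDrift g b) := by
  have hi := fun a => ((LocHolder.sqrt_det hα hg h0).mul hα
    (LocHolder.inv_apply hα hg h0 a b)).pd a
  have hd := (LocHolder.det hα fun a b => (hg a b).of_le hα (Nat.le_succ m)).rpow hα h0 (1 / 2)
  have hd0 : 0 < (g 0).det ^ (1 / 2 : ℝ) := Real.rpow_pos_of_pos h0 _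
  have := (hd.rpow hα hd0 (-1)).mul hα (LocHolder.sum Finset.univ fun a _ => hi a)
  simp only [Real.rpow_neg_one, ← Real.sqrt_eq_rpow] at this
  exact this

lemma confLap_eq_neg_diffOp {n : ℕ} {g : Met n} {u : Pt n → ℝ} {x : Pt n}
    (hdet : 0 < (g x).det)
    (hw : ∀ a b, DifferentiableAt ℝ (fun y => Real.sqrt (g y).det * (g y)⁻¹ a b) x)
    (hu : ∀ b, DifferentiableAt ℝ (pd b u) x) :
    confLap g u x = -diffOp (fun a b y => (g y)⁻¹ a b) (laplaceDrift g)
      (fun y => -(((n : ℝ) - 2) / (4 * ((n : ℝ) - 1))) * scalarCurv g y) u x := by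
  have hs : Real.sqrt (g x).det ≠ 0 := (Real.sqrt_pos.2 hdet).ne'
  have h1 : ∀ a, pd a (fun y => Real.sqrt (g y).det * ∑ b, (g y)⁻¹ a b * pd b u y) x =
      ∑ b, (pd a (fun y => Real.sqrt (g y).det * (g y)⁻¹ a b) x * pd b u x +
        Real.sqrt (g x).det * (g x)⁻¹ a b * pd a (pd b u) x) := by
    intro a
    simp only [Finset.mul_sum, ← mul_assoc]
    refine (pd_sum Finset.univ (f := fun b y => Real.sqrt (g y).det * (g y)⁻¹ a b * pd b u y)
      (fun b _ => (hw a b).mul (hu b)) a).trans ?_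
    exact Finset.sum_congr rfl fun b _ => pd_mul (hw a b) (hu b) a
  have h2 : (Real.sqrt (g x).det)⁻¹ * ∑ a, ∑ b, Real.sqrt (g x).det * (g x)⁻¹ a b *
      pd a (pd b u) x = ∑ a, ∑ b, (g x)⁻¹ a b * pd a (pd b u) x := by
    simp only [Finset.mul_sum]
    refine Finset.sum_congr rfl fun a _ => Finset.sum_congr rfl fun b _ => ?_
    field_simp
  have h3 : (Real.sqrt (g x).det)⁻¹ * ∑ a, ∑ b,
      pd a (fun y => Real.sqrt (g y).det * (g y)⁻¹ a b) x * pd b u x =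
      ∑ b, laplaceDrift g b x * pd b u x := by
    rw [Finset.sum_comm]
    simp only [laplaceDrift, Finset.mul_sum, Finset.sum_mul, mul_assoc]
  simp only [confLap, laplaceBeltrami, h1, diffOp, Finset.sum_add_distrib]
  rw [← h2, ← h3]
  ring

lemma exists_confLap_solution {n m : ℕ} (hn : 0 < n) {α : ℝ} (hα : α ∈ Ioo (0 : ℝ) 1)
    {Ω : Set (Pt n)} (hΩ : IsOpen Ω) (h0 : (0 : Pt n) ∈ Ω) {g : Met n} (hgm : IsMetricOn g Ω)
    (hgr : MetCHolderOn (m + 2) α Ω g) (t : ℝ) (σ : Pt n) :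
    ∃ ρ > 0, Metric.ball (0 : Pt n) ρ ⊆ Ω ∧ ∃ u, CHolderOn (m + 2) α (Metric.ball 0 ρ) u ∧
      (∀ x ∈ Metric.ball (0 : Pt n) ρ, confLap g u x = 0) ∧ u 0 = t ∧ ∀ a, pd a u 0 = σ a := by
  have hdet : ∀ x ∈ Ω, 0 < (g x).det := fun x hx => (hgm x hx).2.det_pos
  have hg2 : ∀ a b, LocHolder α (m + 2) fun x => g x a b := fun a b =>
    LocHolder.of_cHolderOn hα hΩ h0 (hgr a b)
  have hg1 : ∀ a b, LocHolder α (m + 1) fun x => g x a b := fun a b =>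
    (hg2 a b).of_le hα (Nat.le_succ _)
  have hg0 : ∀ a b, LocHolder α m fun x => g x a b := fun a b =>
    (hg1 a b).of_le hα (Nat.le_succ _)
  have hd0 := hdet 0 h0
  set A : Fin n → Fin n → Pt n → ℝ := fun a b y => (g y)⁻¹ a b with hA
  set c : Pt n → ℝ := fun y => -(((n : ℝ) - 2) / (4 * ((n : ℝ) - 1))) * scalarCurv g y with hc
  obtain ⟨N, r, hr, hcom⟩ := LocHolder.exists_common (α := α) (m := m) Finset.univ
    (F := Sum.elim (fun p : Fin n × Fin n => A p.1 p.2)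
      (Sum.elim (laplaceDrift g) fun _ : Unit => c)) (by
    rintro (⟨a, b⟩ | b | _) -
    · exact LocHolder.inv_apply hα hg0 hd0 a b
    · exact LocHolder.laplaceDrift hα hg1 hd0 b
    · exact (LocHolder.scalarCurv hα hg2 hd0).const_mul _)
  have hw : ∀ᶠ x in nhds (0 : Pt n), x ∈ Ω ∧
      ∀ a b, DifferentiableAt ℝ (fun y => Real.sqrt (g y).det * (g y)⁻¹ a b) x := by
    refine Filter.Eventually.and (hΩ.mem_nhds h0) ?_
    simp only [Filter.eventually_all]
    exact fun a b => ((LocHolder.sqrt_det hα hg1 hd0).mul hα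
      (LocHolder.inv_apply hα hg1 hd0 a b)).eventually_differentiableAt
  obtain ⟨r', hr', hw⟩ := LocHolder.exists_ball_of_eventually hw
  have hsub : Metric.ball (0 : Pt n) (min r r') ⊆ Metric.ball 0 r :=
    Metric.ball_subset_ball (min_le_left _ _)
  obtain ⟨ρ, hρ, hρr, M, u, hu, hLu, hu0, hdu⟩ := exists_local_solution hα hn
    (hgm 0 h0).1 (hgm 0 h0).2 (lt_min hr hr')
    (fun a b => (hcom (Sum.inl (a, b)) (Finset.mem_univ _)).mono_set hsub) (fun _ _ => rfl)
    (fun b => (hcom (Sum.inr (Sum.inl b)) (Finset.mem_univ _)).mono_set hsub)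
    ((hcom (Sum.inr (Sum.inr ())) (Finset.mem_univ _)).mono_set hsub) t σ
  have hball : ∀ x ∈ Metric.ball (0 : Pt n) ρ, x ∈ Metric.ball (0 : Pt n) r' := fun x hx =>
    Metric.ball_subset_ball (hρr.trans (min_le_right _ _)) hx
  refine ⟨ρ, hρ, fun x hx => (hw x (hball x hx)).1, u,
    hu.cHolderOn hα.1 Metric.isOpen_ball, fun x hx => ?_, hu0, hdu⟩
  rw [confLap_eq_neg_diffOp (hdet x (hw x (hball x hx)).1) (hw x (hball x hx)).2
    fun b => (hu.pd b).differentiableAt x hx]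
  exact neg_eq_zero.2 (hLu x hx)

/-- Lemma B.1, part 1: local solutions of the conformal Laplace equation with
prescribed value and differential at the origin. -/
theorem conformal_laplace_local_solutions_interior
    (n k : ℕ) (hn : 3 ≤ n) (hk : 2 ≤ k) (α : ℝ) (hα : α ∈ Set.Ioo (0 : ℝ) 1)
    (Ω : Set (Pt n)) (hΩ : IsOpen Ω) (h0 : (0 : Pt n) ∈ Ω)
    (g : Met n) (hgm : IsMetricOn g Ω) (hgr : MetCHolderOn k α Ω g) :
    (∀ σ : Pt n, ∃ ε > (0 : ℝ), Metric.closedBall (0 : Pt n) ε ⊆ Ω ∧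
      ∃ (W : Set (Pt n)) (fσ : Pt n → ℝ), IsOpen W ∧ Metric.closedBall (0 : Pt n) ε ⊆ W ∧
        CHolderOn k α W fσ ∧
        (∀ x ∈ Metric.closedBall (0 : Pt n) ε, confLap g fσ x = 0) ∧
        fσ 0 = 0 ∧ (∀ a : Fin n, pd a fσ 0 = σ a)) ∧
    (∃ ε > (0 : ℝ), Metric.closedBall (0 : Pt n) ε ⊆ Ω ∧
      ∃ (W : Set (Pt n)) (f : Pt n → ℝ), IsOpen W ∧ Metric.closedBall (0 : Pt n) ε ⊆ W ∧
        CHolderOn k α W f ∧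
        (∀ x ∈ Metric.closedBall (0 : Pt n) ε, confLap g f x = 0) ∧
        (∀ x ∈ Metric.closedBall (0 : Pt n) ε, 0 < f x) ∧ f 0 = 1) := by
  obtain ⟨m, rfl⟩ := Nat.exists_eq_add_of_le' hk
  constructor
  · intro σ
    obtain ⟨ρ, hρ, hρΩ, u, hu, hLu, hu0, hdu⟩ :=
      exists_confLap_solution (by omega) hα hΩ h0 hgm hgr 0 σ
    have hsub : Metric.closedBall (0 : Pt n) (ρ / 2) ⊆ Metric.ball 0 ρ :=
      Metric.closedBall_subset_ball (by linarith)
    exact ⟨ρ / 2, by positivity, hsub.trans hρΩ, Metric.ball 0 ρ, u, Metric.isOpen_ball, hsub,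
      hu, fun x hx => hLu x (hsub hx), hu0, hdu⟩
  · obtain ⟨ρ, hρ, hρΩ, u, hu, hLu, hu0, -⟩ :=
      exists_confLap_solution (by omega) hα hΩ h0 hgm hgr 1 0
    have hpos : ∀ᶠ x in nhds (0 : Pt n), 0 < u x :=
      (hu.1.continuousOn.continuousAt (Metric.ball_mem_nhds _ hρ)).eventually_const_lt
        (by rw [hu0]; exact one_pos)
    obtain ⟨r, hr, hpos⟩ := LocHolder.exists_ball_of_eventually hpos
    have hsub : Metric.closedBall (0 : Pt n) (min ρ r / 2) ⊆ Metric.ball 0 (min ρ r) :=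
      Metric.closedBall_subset_ball (by linarith [lt_min hρ hr])
    have hsub1 := hsub.trans (Metric.ball_subset_ball (min_le_left ρ r))
    have hsub2 := hsub.trans (Metric.ball_subset_ball (min_le_right ρ r))
    exact ⟨min ρ r / 2, half_pos (lt_min hρ hr), hsub1.trans hρΩ, Metric.ball 0 ρ, u,
      Metric.isOpen_ball, hsub1, hu, fun x hx => hLu x (hsub1 hx),
      fun x hx => hpos x (hsub2 hx), hu0⟩
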